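/- arXiv:1502.00409 — 5 statements merged into one kernel-verified Lean document; each statement's English description precedes it below -/
import Mathlib

section
/- There exists a class F of finite simple graphs, closed under isomorphism and under taking induced subgraphs (i.e., hereditary), such that: (a) every graph G ∈ F on n ≥ 4 vertices satisfies sepV(G) ≤ (n/log n)·(log log n)²; and (b) for every real C > 0 there exist an integer n and an n-vertex graph in F with more than C·n edges. -/
open SimpleGraph

/-- The set of edges of `G` with exactly one endpoint in `A`. -/
noncomputable def cutEdges {V : Type*} (G : SimpleGraph V) (A : Set V) : Set (Sym2 V) :=
  {e | e ∈ G.edgeSet ∧ ∃ u ∈ A, ∃ v ∈ Aᶜ, e = s(u, v)}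

/-- `sepV G`: minimum size of a vertex separator of `G`. -/
noncomputable def sepV {V : Type*} (G : SimpleGraph V) : ℕ :=
  sInf { m : ℕ | ∃ S A B : Set V, S ∪ A ∪ B = Set.univ ∧
      Disjoint S A ∧ Disjoint S B ∧ Disjoint A B ∧
      3 * A.ncard ≤ 2 * Nat.card V ∧ 3 * B.ncard ≤ 2 * Nat.card V ∧
      (∀ a ∈ A, ∀ b ∈ B, ¬ G.Adj a b) ∧ m = S.ncard }

/-- The finite vertex set `X` has a separator in `G` of size at most `b`: it splits into `S`, `A`
and `B` with no edge between `A` and `B`, both of size at most two thirds of that of `X`. -/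
def HasSeparator {V : Type*} [DecidableEq V] (G : SimpleGraph V) (X : Finset V) (b : ℝ) : Prop :=
  ∃ S A B : Finset V, S ∪ A ∪ B = X ∧ Disjoint S A ∧ Disjoint S B ∧ Disjoint A B ∧
    3 * A.card ≤ 2 * X.card ∧ 3 * B.card ≤ 2 * X.card ∧
    (∀ a ∈ A, ∀ b ∈ B, ¬ G.Adj a b) ∧ (S.card : ℝ) ≤ b

/-- `A` is separated from the rest of `Y` by `S`, and has at most half of the vertices of `Y`. -/
structure IsCutOff {V : Type*} [DecidableEq V] (G : SimpleGraph V) (Y A S : Finset V) : Prop where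
  left_subset : A ⊆ Y
  right_subset : S ⊆ Y
  disjoint : Disjoint A S
  two_mul_card_le : 2 * A.card ≤ Y.card
  mem_of_adj : ∀ a ∈ A, ∀ y ∈ Y, G.Adj a y → y ∈ A ∨ y ∈ S

/-- If every large subset of `X` has a sparse cut, then these cuts combine to a separator. -/
theorem hasSeparator_of_sparse_cuts {V : Type*} [DecidableEq V] (G : SimpleGraph V)
    (X : Finset V) (φ : ℝ) (h0 : 0 ≤ φ) (h1 : φ ≤ 1 / 2)
    (h : ∀ Y ⊆ X, X.card ≤ 2 * Y.card → ∃ A S, IsCutOff G Y A S ∧ A.Nonempty ∧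
      (S.card : ℝ) ≤ φ * A.card) :
    HasSeparator G X (φ * X.card) := by
  classical
  let P : Finset V × Finset V → Prop := fun Z => Disjoint Z.1 Z.2 ∧
    (∀ z ∈ Z.1, ∀ y ∈ X, G.Adj z y → y ∈ Z.1 ∨ y ∈ Z.2) ∧ (Z.2.card : ℝ) ≤ φ * Z.1.card ∧
    3 * Z.1.card ≤ 2 * X.card
  obtain ⟨⟨Z, S⟩, hZ, hmax⟩ := Finset.exists_max_image
    ((X.powerset ×ˢ X.powerset).filter P) (fun Z => Z.1.card) ⟨(∅, ∅), by simp [P]⟩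
  simp only [Finset.mem_filter, Finset.mem_product, Finset.mem_powerset, P] at hZ hmax
  obtain ⟨⟨hZX, hSX⟩, hd, hadj, hS, h3⟩ := hZ
  have hZS : Disjoint Z S := hd
  have hsub : Z ∪ S ⊆ X := Finset.union_subset hZX hSX
  have hcard : (X \ (Z ∪ S)).card + (Z.card + S.card) = X.card := by
    rw [← Finset.card_union_of_disjoint hZS]
    exact Finset.card_sdiff_add_card_eq_card hsub
  have hcardR : ((X \ (Z ∪ S)).card : ℝ) + (Z.card + S.card) = X.card := by exact_mod_cast hcard
  have hZc : (Z.card : ℝ) ≤ X.card := by exact_mod_cast Finset.card_le_card hZX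
  by_cases hbig : X.card ≤ 3 * Z.card
  · refine ⟨S, Z, X \ (Z ∪ S), ?_, hZS.symm, ?_, ?_, h3, by omega, ?_, ?_⟩
    · rw [Finset.union_comm S Z]; exact Finset.union_sdiff_of_subset hsub
    · exact Finset.disjoint_sdiff.mono_left Finset.subset_union_right
    · exact Finset.disjoint_sdiff.mono_left Finset.subset_union_left
    · intro a ha b hb hab
      rw [Finset.mem_sdiff, Finset.mem_union] at hb
      exact hb.2 (hadj a ha b hb.1 hab)
    · exact hS.trans (by gcongr)
  · exfalso
    push Not at hbig
    obtain ⟨A, T, hc, hA, hT⟩ := h (X \ (Z ∪ S)) Finset.sdiff_subset (by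
      have h3' : (3 * Z.card : ℝ) < X.card := by exact_mod_cast hbig
      have : (S.card : ℝ) ≤ 1 / 2 * Z.card := hS.trans (by gcongr)
      have : (X.card : ℝ) ≤ 2 * (X \ (Z ∪ S)).card := by linarith
      exact_mod_cast this)
    have hAZ : Disjoint Z A := by
      refine Finset.disjoint_of_subset_right hc.left_subset ?_
      exact Finset.disjoint_sdiff.mono_left Finset.subset_union_left
    have hAS : Disjoint S A := by
      refine Finset.disjoint_of_subset_right hc.left_subset ?_
      exact Finset.disjoint_sdiff.mono_left Finset.subset_union_right
    have hTZ : Disjoint Z T := by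
      refine Finset.disjoint_of_subset_right hc.right_subset ?_
      exact Finset.disjoint_sdiff.mono_left Finset.subset_union_left
    have hcA := hc.two_mul_card_le
    have hun : (Z ∪ A).card = Z.card + A.card := Finset.card_union_of_disjoint hAZ
    have hle := hmax (Z ∪ A, S ∪ T) ⟨⟨Finset.union_subset hZX
      (hc.left_subset.trans Finset.sdiff_subset), Finset.union_subset hSX
      (hc.right_subset.trans Finset.sdiff_subset)⟩, ?_, ?_, ?_, ?_⟩
    · have := hA.card_pos
      simp only [hun] at hle
      omega
    · rw [Finset.disjoint_union_left, Finset.disjoint_union_right, Finset.disjoint_union_right]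
      exact ⟨⟨hZS, hTZ⟩, hAS.symm, hc.disjoint⟩
    · intro z hz y hy hzy
      simp only [Finset.mem_union] at hz ⊢
      by_cases hyZ : y ∈ Z ∪ S
      · rw [Finset.mem_union] at hyZ; tauto
      · rcases hz with hz | hz
        · have := hadj z hz y hy hzy
          tauto
        · have := hc.mem_of_adj z hz y (Finset.mem_sdiff.2 ⟨hy, hyZ⟩) hzy
          tauto
    · simp only [hun]
      have : ((S ∪ T).card : ℝ) ≤ S.card + T.card := by exact_mod_cast Finset.card_union_le S T
      push_cast
      linarith
    · simp only [hun]; omega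

/-- A finite forest has a vertex whose removal separates a third of the vertices. -/
theorem SimpleGraph.IsAcyclic.exists_separating_vertex {V : Type*} [DecidableEq V]
    {T : SimpleGraph V} (hT : T.IsAcyclic) (F : Finset V) (hF : F.Nonempty) :
    ∃ v ∈ F, ∃ Z ⊆ F, v ∉ Z ∧ (∀ z ∈ Z, ∀ y ∈ F, T.Adj z y → y ∈ Z ∨ y = v) ∧
      3 * Z.card ≤ 2 * F.card ∧ F.card ≤ 3 * Z.card + 3 := by
  classical
  let P : V × Finset V → Prop := fun Z => Z.1 ∉ Z.2 ∧
    (∀ z ∈ Z.2, ∀ y ∈ F, T.Adj z y → y ∈ Z.2 ∨ y = Z.1) ∧ 3 * Z.2.card ≤ 2 * F.card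
  obtain ⟨v0, hv0⟩ := hF
  obtain ⟨⟨v, Z⟩, hZ, hmax⟩ := Finset.exists_max_image
    ((F ×ˢ F.powerset).filter P) (fun Z => Z.2.card) ⟨(v0, ∅), by simp [P, hv0]⟩
  simp only [Finset.mem_filter, Finset.mem_product, Finset.mem_powerset, P] at hZ hmax
  obtain ⟨⟨hv, hZF⟩, hvZ, hadj, h3⟩ := hZ
  refine ⟨v, hv, Z, hZF, hvZ, hadj, h3, ?_⟩
  by_contra! hlt
  set B := F \ insert v Z with hB
  have hBcard : B.card + (Z.card + 1) = F.card := by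
    rw [← Finset.card_insert_of_notMem hvZ]
    exact Finset.card_sdiff_add_card_eq_card (Finset.insert_subset hv hZF)
  have hBmem : ∀ y, y ∈ B ↔ y ∈ F ∧ y ≠ v ∧ y ∉ Z := by
    intro y; simp [hB]
  by_cases hex : ∃ u ∈ B, T.Adj v u
  · obtain ⟨u, huB, hvu⟩ := hex
    have huB' := (hBmem u).1 huB
    let K : SimpleGraph (B : Set V) := T.induce (B : Set V)
    let D : Finset V := B.filter fun w => ∃ hw : w ∈ B, K.Reachable ⟨u, huB⟩ ⟨w, hw⟩
    have hDB : D ⊆ B := Finset.filter_subset _ _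
    have huD : u ∈ D := Finset.mem_filter.2 ⟨huB, huB, Reachable.refl _⟩
    have hDadj : ∀ w ∈ D, ∀ y ∈ B, T.Adj w y → y ∈ D := by
      intro w hw y hy hwy
      obtain ⟨hwB, _, hr⟩ := Finset.mem_filter.1 hw
      refine Finset.mem_filter.2 ⟨hy, hy, hr.trans (Adj.reachable ?_)⟩
      exact hwy
    have huniq : ∀ w ∈ D, T.Adj v w → w = u := by
      intro w hw hvw
      by_contra hne
      obtain ⟨hwB, _, hr⟩ := Finset.mem_filter.1 hw
      have hbr := (isAcyclic_iff_forall_adj_isBridge.1 hT) hvu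
      rw [isBridge_iff] at hbr
      refine hbr ?_
      have hvB : v ∉ B := fun h => ((hBmem v).1 h).2.1 rfl
      have hwv : (T \ fromEdgeSet {s(v, u)}).Adj v w := by
        simp [hvw, hne, Ne.symm huB'.2.1]
      let f : K →g (T \ fromEdgeSet {s(v, u)}) :=
        { toFun := Subtype.val
          map_rel' := by
            intro a b hab
            have ha : (a : V) ≠ v := fun h => hvB (h ▸ a.2)
            have hb : (b : V) ≠ v := fun h => hvB (h ▸ b.2)
            have hab' : T.Adj a b := hab
            simp [hab', ha, hb] }
      exact hwv.reachable.trans (hr.map f).symm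
    have hZadj : ∀ z ∈ Z, ∀ w ∈ D, ¬ T.Adj z w := by
      intro z hz w hw hzw
      have := (hBmem w).1 (hDB hw)
      rcases hadj z hz w this.1 hzw with h | h
      · exact this.2.2 h
      · exact this.2.1 h
    have hdisj : Disjoint Z D := by
      rw [Finset.disjoint_left]
      intro z hz hzD
      exact ((hBmem z).1 (hDB hzD)).2.2 hz
    have hDF : D ⊆ F := fun w hw => ((hBmem w).1 (hDB hw)).1
    have hDpos : 0 < D.card := Finset.card_pos.2 ⟨u, huD⟩
    by_cases hs : 3 * (Z.card + D.card) ≤ 2 * F.card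
    · have := hmax (v, Z ∪ D) ⟨⟨hv, Finset.union_subset hZF hDF⟩, ?_, ?_, ?_⟩
      · rw [Finset.card_union_of_disjoint hdisj] at this
        omega
      · rw [Finset.mem_union]
        rintro (h | h)
        · exact hvZ h
        · exact ((hBmem v).1 (hDB h)).2.1 rfl
      · intro z hz y hy hzy
        rw [Finset.mem_union] at hz ⊢
        by_cases hyB : y ∈ B
        · rcases hz with hz | hz
          · have := hadj z hz y hy hzy; tauto
          · exact Or.inl (Or.inr (hDadj z hz y hyB hzy))
        · rw [hBmem] at hyB; tauto
      · rw [Finset.card_union_of_disjoint hdisj]; exact hs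
    · have hcF : (F \ D).card + D.card = F.card := Finset.card_sdiff_add_card_eq_card hDF
      have hle : D.card ≤ B.card := Finset.card_le_card hDB
      have := hmax (u, F \ D) ⟨⟨huB'.1, Finset.sdiff_subset⟩, ?_, ?_, ?_⟩
      · simp only at this
        omega
      · simp [huD]
      · intro z hz y hy hzy
        rw [Finset.mem_sdiff] at hz
        by_cases hyD : y ∈ D
        · right
          by_cases hzv : z = v
          · subst hzv
            exact huniq y hyD hzy
          · by_cases hzZ : z ∈ Z
            · exact absurd hzy (hZadj z hzZ y hyD)
            · exact absurd (hDadj y hyD z ((hBmem z).2 ⟨hz.1, hzv, hzZ⟩) hzy.symm) hz.2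
        · left; exact Finset.mem_sdiff.2 ⟨hy, hyD⟩
      · simp only; omega
  · push Not at hex
    obtain ⟨u, hu⟩ : B.Nonempty := Finset.card_pos.1 (by omega)
    have hu' := (hBmem u).1 hu
    have := hmax (u, insert v Z) ⟨⟨hu'.1, Finset.insert_subset hv hZF⟩, ?_, ?_, ?_⟩
    · rw [Finset.card_insert_of_notMem hvZ] at this
      omega
    · simp [hu'.2.1, hu'.2.2]
    · intro z hz y hy hzy
      left
      by_contra hn
      rw [Finset.mem_insert] at hz hn
      push Not at hn
      have hyB : y ∈ B := (hBmem y).2 ⟨hy, hn⟩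
      rcases hz with rfl | hz
      · exact hex y hyB hzy
      · have := hadj z hz y hy hzy; tauto
    · rw [Finset.card_insert_of_notMem hvZ]; omega

theorem exists_isCutOff_univ_of_not_connected {W : Type*} [Fintype W] [Nonempty W]
    [DecidableEq W] (G : SimpleGraph W) (h : ¬ G.Connected) :
    ∃ A : Finset W, IsCutOff G Finset.univ A ∅ ∧ A.Nonempty := by
  classical
  rw [connected_iff] at h
  have h' : ¬ G.Preconnected := fun hp => h ⟨hp, inferInstance⟩
  simp only [Preconnected] at h'
  push Not at h'
  obtain ⟨u, w, huw⟩ := h'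
  let R : Finset W := Finset.univ.filter fun v => G.Reachable u v
  have hcard : R.card + Rᶜ.card = (Finset.univ : Finset W).card := by
    simp
  by_cases hle : 2 * R.card ≤ (Finset.univ : Finset W).card
  · refine ⟨R, ⟨Finset.subset_univ _, Finset.subset_univ _, by simp, hle, ?_⟩,
      ⟨u, by simp [R]⟩⟩
    intro a ha y _ hay
    left
    simp only [R, Finset.mem_filter, Finset.mem_univ, true_and] at ha ⊢
    exact ha.trans hay.reachable
  · refine ⟨Rᶜ, ⟨Finset.subset_univ _, Finset.subset_univ _, by simp, by omega, ?_⟩,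
      ⟨w, by simpa [R] using huw⟩⟩
    intro a ha y _ hay
    left
    simp only [R, Finset.mem_filter, Finset.mem_univ, true_and, Finset.mem_compl] at ha ⊢
    exact fun hy => ha (hy.trans hay.symm.reachable)

/-- A finite connected graph with few edges more than a spanning tree has a sparse cut. -/
theorem exists_isCutOff_univ_of_connected {W : Type*} [Fintype W] [DecidableEq W]
    (G : SimpleGraph W) (h : G.Connected) (E : Finset (W × W))
    (hE : ∀ v w, G.Adj v w → (v, w) ∈ E ∨ (w, v) ∈ E) {e : ℕ}
    (he : E.card + 1 ≤ Fintype.card W + e) (hcard : 4 * e + 12 ≤ Fintype.card W) :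
    ∃ A S : Finset W, IsCutOff G Finset.univ A S ∧
      Fintype.card W ≤ 4 * A.card ∧ S.card ≤ e + 1 := by
  classical
  obtain ⟨T, hTG, hT⟩ := h.exists_isTree_le
  have hTe := hT.card_edgeFinset
  set ET := E.filter fun p => T.Adj p.1 p.2 with hET
  set EN := E.filter fun p => ¬ T.Adj p.1 p.2 with hEN
  have hsum : ET.card + EN.card = E.card := Finset.card_filter_add_card_filter_not _
  have hETc : T.edgeFinset.card ≤ ET.card := by
    refine le_trans (Finset.card_le_card ?_) (Finset.card_image_le (f := fun p => s(p.1, p.2)))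
    intro x
    induction x with | _ v w =>
    intro hx
    rw [mem_edgeFinset, mem_edgeSet] at hx
    rw [Finset.mem_image]
    rcases hE v w (hTG hx) with h1 | h1
    · exact ⟨(v, w), by simp [hET, h1, hx], rfl⟩
    · exact ⟨(w, v), by simp [hET, h1, hx.symm], Sym2.eq_swap⟩
  set S0 := EN.image Prod.fst with hS0
  have hS0c : S0.card ≤ e := by
    have : S0.card ≤ EN.card := Finset.card_image_le
    omega
  have hFc : S0ᶜ.card + S0.card = Fintype.card W := by
    have := Finset.card_add_card_compl S0
    omega
  have hG : ∀ v ∉ S0, ∀ w ∉ S0, G.Adj v w → T.Adj v w := by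
    intro v hv w hw hvw
    by_contra hn
    rcases hE v w hvw with h1 | h1
    · exact hv (Finset.mem_image.2 ⟨(v, w), by simp [hEN, h1, hn], rfl⟩)
    · refine hw (Finset.mem_image.2 ⟨(w, v), ?_, rfl⟩)
      simp [hEN, h1, T.adj_comm w v, hn]
  obtain ⟨v, hv, Z, hZ, hvZ, hadj, hZ1, hZ2⟩ :=
    hT.isAcyclic.exists_separating_vertex S0ᶜ (Finset.card_pos.1 (by omega))
  have hSc : (insert v S0).card ≤ e + 1 := (Finset.card_insert_le _ _).trans (by omega)
  set B := S0ᶜ \ insert v Z with hB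
  have hBc : B.card + (Z.card + 1) = S0ᶜ.card := by
    rw [← Finset.card_insert_of_notMem hvZ]
    exact Finset.card_sdiff_add_card_eq_card (Finset.insert_subset hv hZ)
  have hBm : ∀ y, y ∈ B ↔ y ∉ S0 ∧ y ≠ v ∧ y ∉ Z := by
    intro y; simp [hB]
  have hZm : ∀ z ∈ Z, z ∉ S0 := fun z hz => by simpa using hZ hz
  by_cases hle : Z.card ≤ B.card
  · refine ⟨Z, insert v S0, ⟨Finset.subset_univ _, Finset.subset_univ _, ?_, ?_, ?_⟩, ?_, hSc⟩
    · rw [Finset.disjoint_insert_right]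
      exact ⟨hvZ, Finset.disjoint_left.2 hZm⟩
    · rw [Finset.card_univ]; omega
    · intro a ha y _ hay
      by_cases hy : y ∈ S0
      · exact Or.inr (Finset.mem_insert_of_mem hy)
      · rcases hadj a ha y (by simpa using hy) (hG a (hZm a ha) y hy hay) with h1 | h1
        · exact Or.inl h1
        · exact Or.inr (h1 ▸ Finset.mem_insert_self _ _)
    · omega
  · refine ⟨B, insert v S0, ⟨Finset.subset_univ _, Finset.subset_univ _, ?_, ?_, ?_⟩, ?_, hSc⟩
    · rw [Finset.disjoint_insert_right]
      exact ⟨fun h => ((hBm v).1 h).2.1 rfl, Finset.disjoint_left.2 fun z hz => ((hBm z).1 hz).1⟩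
    · rw [Finset.card_univ]; omega
    · intro a ha y _ hay
      have ha' := (hBm a).1 ha
      rw [hBm, Finset.mem_insert]
      by_cases hy : y ∈ S0
      · exact Or.inr (Or.inr hy)
      · by_cases hyZ : y ∈ Z
        · have := hadj y hyZ a (by simpa using ha'.1) (hG a ha'.1 y hy hay).symm
          tauto
        · tauto
    · omega

theorem IsCutOff.map {V : Type*} [DecidableEq V] {G : SimpleGraph V} {Y : Finset V}
    {A S : Finset Y} (h : IsCutOff (G.comap (Subtype.val : Y → V)) Finset.univ A S) :
    IsCutOff G Y (A.map (Function.Embedding.subtype _)) (S.map (Function.Embedding.subtype _)) := by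
  refine ⟨?_, ?_, ?_, ?_, ?_⟩
  · intro x hx
    obtain ⟨y, _, rfl⟩ := Finset.mem_map.1 hx
    exact y.2
  · intro x hx
    obtain ⟨y, _, rfl⟩ := Finset.mem_map.1 hx
    exact y.2
  · exact (Finset.disjoint_map _).2 h.disjoint
  · have := h.two_mul_card_le
    rw [Finset.card_univ, Fintype.card_coe] at this
    rwa [Finset.card_map]
  · intro a ha y hy hay
    obtain ⟨a, ha', rfl⟩ := Finset.mem_map.1 ha
    have := h.mem_of_adj a ha' ⟨y, hy⟩ (Finset.mem_univ _) hay
    simpa [hy] using this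

/-- A graph whose edges are covered by a number of arcs only slightly larger than the number of
vertices has a sparse cut. -/
theorem exists_isCutOff_of_few_arcs {V : Type*} [DecidableEq V] (G : SimpleGraph V)
    (Arc : V → V → Prop) [DecidableRel Arc] (hArc : ∀ v w, G.Adj v w → Arc v w ∨ Arc w v)
    (Y : Finset V) {D : ℕ} (hD : 16 ≤ D) (hY : 24 ≤ Y.card)
    (hc : D * ((Y ×ˢ Y).filter fun p => Arc p.1 p.2).card ≤ (D + 1) * Y.card) :
    ∃ A S, IsCutOff G Y A S ∧ A.Nonempty ∧
      (S.card : ℝ) ≤ (4 / D + 8 / Y.card) * A.card := by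
  classical
  have hYne : Y.Nonempty := Finset.card_pos.1 (by omega)
  have : Nonempty Y := hYne.to_subtype
  by_cases hcon : (G.comap (Subtype.val : Y → V)).Connected
  · let E : Finset (Y × Y) := Finset.univ.filter fun p => Arc p.1 p.2
    have hEc : E.card ≤ ((Y ×ˢ Y).filter fun p => Arc p.1 p.2).card := by
      refine Finset.card_le_card_of_injOn (fun p => (p.1.1, p.2.1)) ?_ ?_
      · intro p hp
        have : Arc p.1 p.2 := by simpa [E] using hp
        simp [this]
      · rintro ⟨p1, p2⟩ _ ⟨q1, q2⟩ _ hpq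
        exact Prod.ext (Subtype.ext (congrArg Prod.fst hpq)) (Subtype.ext (congrArg Prod.snd hpq))
    have hb : E.card ≤ Y.card + Y.card / D := by
      have h1 : D * E.card ≤ (D + 1) * Y.card := (Nat.mul_le_mul_left _ hEc).trans hc
      have h2 : E.card ≤ (Y.card + Y.card * D) / D := by
        rw [Nat.le_div_iff_mul_le (by omega)]
        linarith
      rw [Nat.add_mul_div_right _ _ (by omega)] at h2
      omega
    have hdiv : Y.card / D ≤ Y.card / 16 := Nat.div_le_div_left hD (by norm_num)
    obtain ⟨A, S, hAS, hA, hS⟩ := exists_isCutOff_univ_of_connected _ hcon E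
      (fun v w hvw => by simpa [E] using hArc _ _ hvw) (e := Y.card / D + 1)
      (by rw [Fintype.card_coe]; omega)
      (by rw [Fintype.card_coe]; omega)
    rw [Fintype.card_coe] at hA
    refine ⟨_, _, hAS.map, ?_, ?_⟩
    · rw [Finset.map_nonempty, ← Finset.card_pos]; omega
    · rw [Finset.card_map, Finset.card_map]
      have hS' : (S.card : ℝ) ≤ Y.card / D + 2 := by
        have h1 : (S.card : ℝ) ≤ (Y.card / D + 1 + 1 : ℕ) := by exact_mod_cast hS
        have h2 : ((Y.card / D : ℕ) : ℝ) ≤ Y.card / D := Nat.cast_div_le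
        push_cast at h1
        linarith
      have hA' : (Y.card : ℝ) ≤ 4 * A.card := by exact_mod_cast hA
      have hYp : (0 : ℝ) < Y.card := by exact_mod_cast hYne.card_pos
      calc (S.card : ℝ) ≤ Y.card / D + 2 := hS'
        _ = (4 / D + 8 / Y.card) * (Y.card / 4) := by field_simp; ring
        _ ≤ _ := by gcongr; linarith
  · obtain ⟨A, hA, hAne⟩ := exists_isCutOff_univ_of_not_connected _ hcon
    refine ⟨_, _, hA.map, by simpa using hAne, ?_⟩
    simp only [Finset.map_empty, Finset.card_empty, Nat.cast_zero]
    positivity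

/-- If all paths in `Y` are short, then depth-first search finds a balanced cut. -/
theorem exists_isCutOff_of_short_paths {V : Type*} [DecidableEq V] (G : SimpleGraph V)
    (Y : Finset V) (ℓ : ℕ)
    (h : ∀ l : List V, l.Nodup → l.IsChain G.Adj → (∀ v ∈ l, v ∈ Y) → l.length ≤ ℓ) :
    ∃ A S, IsCutOff G Y A S ∧ S.card ≤ ℓ ∧ Y.card ≤ 2 * A.card + ℓ := by
  suffices key : ∀ (k : ℕ) (A B : Finset V) (l : List V), l.Nodup → l.IsChain G.Adj →
      A ∪ l.toFinset ∪ B = Y → Disjoint A l.toFinset → Disjoint A B → Disjoint l.toFinset B →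
      (∀ a ∈ A, ∀ b ∈ B, ¬ G.Adj a b) → A.card ≤ B.card →
      2 * Y.card ≤ 2 * A.card + l.length + k →
      ∃ A S, IsCutOff G Y A S ∧ S.card ≤ ℓ ∧ Y.card ≤ 2 * A.card + ℓ from
    key (2 * Y.card) ∅ Y [] (by simp) (by simp) (by simp) (by simp) (by simp) (by simp)
      (by simp) (by simp) (by simp)
  intro k
  induction k with
  | zero =>
    intro A B l hl hch hY hAl hAB hlB hadj hle hk
    have hc : Y.card = A.card + l.length + B.card := by
      rw [← hY, Finset.card_union_of_disjoint (Finset.disjoint_union_left.2 ⟨hAB, hlB⟩),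
        Finset.card_union_of_disjoint hAl, List.toFinset_card_of_nodup hl]
    exact ⟨∅, ∅, ⟨by simp, by simp, by simp, by simp, by simp⟩, by simp, by omega⟩
  | succ k ih =>
    intro A B l hl hch hY hAl hAB hlB hadj hle hk
    have hc : Y.card = A.card + l.length + B.card := by
      rw [← hY, Finset.card_union_of_disjoint (Finset.disjoint_union_left.2 ⟨hAB, hlB⟩),
        Finset.card_union_of_disjoint hAl, List.toFinset_card_of_nodup hl]
    have hmem : ∀ y, y ∈ Y ↔ (y ∈ A ∨ y ∈ l) ∨ y ∈ B := by
      intro y; simp [← hY, or_assoc]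
    have hlen : l.length ≤ ℓ := h l hl hch fun v hv => (hmem v).2 (Or.inl (Or.inr hv))
    rw [Finset.disjoint_left] at hAl hAB hlB
    simp only [List.mem_toFinset] at hAl hlB
    by_cases heq : A.card = B.card
    · refine ⟨A, l.toFinset, ⟨?_, ?_, ?_, by omega, ?_⟩,
        (List.toFinset_card_le l).trans hlen, by omega⟩
      · intro y hy; rw [hmem]; tauto
      · intro y hy; rw [List.mem_toFinset] at hy; rw [hmem]; tauto
      · rw [Finset.disjoint_left]; simpa using hAl
      · intro a ha y hy hay
        rw [List.mem_toFinset]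
        have := hadj a ha y
        have := (hmem y).1 hy
        tauto
    have push : ∀ b ∈ B, (b :: l).IsChain G.Adj →
        ∃ A S, IsCutOff G Y A S ∧ S.card ≤ ℓ ∧ Y.card ≤ 2 * A.card + ℓ := by
      intro b hb hch'
      refine ih A (B.erase b) (b :: l) (List.nodup_cons.2 ⟨fun h => hlB h hb, hl⟩) hch' ?_ ?_ ?_ ?_
        (fun a ha c hc => hadj a ha c (Finset.mem_of_mem_erase hc)) ?_ ?_
      · ext y
        rw [hmem]
        simp only [Finset.mem_union, List.mem_toFinset, List.mem_cons, Finset.mem_erase]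
        by_cases hyb : y = b
        · subst hyb; tauto
        · tauto
      · rw [Finset.disjoint_left]
        intro a ha hab
        rw [List.mem_toFinset, List.mem_cons] at hab
        rcases hab with rfl | hab
        · exact hAB ha hb
        · exact hAl ha hab
      · rw [Finset.disjoint_left]
        exact fun a ha hab => hAB ha (Finset.mem_of_mem_erase hab)
      · rw [Finset.disjoint_left]
        intro a ha hab
        rw [List.mem_toFinset, List.mem_cons] at ha
        rw [Finset.mem_erase] at hab
        rcases ha with rfl | ha
        · exact hab.1 rfl
        · exact hlB ha hab.2
      · rw [Finset.card_erase_of_mem hb]; omega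
      · rw [List.length_cons]; omega
    match l with
    | [] =>
      obtain ⟨b, hb⟩ : B.Nonempty := Finset.card_pos.1 (by omega)
      exact push b hb (by simp)
    | u :: l =>
      by_cases hex : ∃ b ∈ B, G.Adj b u
      · obtain ⟨b, hb, hbu⟩ := hex
        exact push b hb (List.isChain_cons_cons.2 ⟨hbu, hch⟩)
      · push Not at hex
        rw [List.nodup_cons] at hl
        have huA : u ∉ A := fun hu => hAl hu (by simp)
        refine ih (insert u A) B l hl.2 hch.tail ?_ ?_ ?_ ?_ ?_ ?_ ?_
        · ext y
          rw [hmem]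
          simp only [Finset.mem_union, List.mem_toFinset, List.mem_cons, Finset.mem_insert]
          tauto
        · rw [Finset.disjoint_left]
          intro a ha hal
          rw [List.mem_toFinset] at hal
          rcases Finset.mem_insert.1 ha with rfl | ha
          · exact hl.1 hal
          · exact hAl ha (by simp [hal])
        · rw [Finset.disjoint_left]
          intro a ha haB
          rcases Finset.mem_insert.1 ha with rfl | ha
          · exact hlB (by simp) haB
          · exact hAB ha haB
        · rw [Finset.disjoint_left]
          intro a ha haB
          rw [List.mem_toFinset] at ha
          exact hlB (by simp [ha]) haB
        · intro a ha b hb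
          rcases Finset.mem_insert.1 ha with rfl | ha
          · exact fun h => hex b hb h.symm
          · exact hadj a ha b hb
        · rw [Finset.card_insert_of_notMem huA]; omega
        · rw [Finset.card_insert_of_notMem huA]
          rw [List.length_cons] at hk
          omega

theorem card_boundary_le {V : Type*} [DecidableEq V] {G : SimpleGraph V}
    {Arc : V → V → Prop} [DecidableRel Arc] (hArc : ∀ v w, G.Adj v w → Arc v w ∨ Arc w v)
    (Y : Finset V) (P : V → Prop) [DecidablePred P] [DecidableRel G.Adj] :
    (Y.filter fun y => ¬ P y ∧ ∃ a ∈ Y, P a ∧ G.Adj a y).card ≤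
      (((Y ×ˢ Y).filter fun p => Arc p.1 p.2).filter fun p => ¬ (P p.1 ↔ P p.2)).card := by
  refine le_trans (Finset.card_le_card ?_)
    (Finset.card_image_le (f := fun p : V × V => if P p.1 then p.2 else p.1))
  intro y hy
  obtain ⟨hyY, hPy, a, haY, hPa, hay⟩ := Finset.mem_filter.1 hy
  rw [Finset.mem_image]
  rcases hArc a y hay with h | h
  · exact ⟨(a, y), by simp [*], by simp [*]⟩
  · exact ⟨(y, a), by simp [*], by simp [*]⟩

theorem sum_card_filter_le {α ι : Type*} (E : Finset α) (J : Finset ι) (P : α → ι → Prop)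
    [∀ a i, Decidable (P a i)]
    (h : ∀ p ∈ E, (J.filter fun j => P p j).card ≤ 1) :
    ∑ j ∈ J, (E.filter fun p => P p j).card ≤ E.card := by
  have := Finset.sum_card_bipartiteAbove_eq_sum_card_bipartiteBelow (s := E) (t := J) P
  simp only [Finset.bipartiteAbove, Finset.bipartiteBelow] at this
  rw [← this, Finset.card_eq_sum_ones]
  exact Finset.sum_le_sum h

/-- Given a map to a cube for which every edge moves by at most one step, a set of vertices has
a sparse cut as soon as there are no long paths in Hamming balls. -/
theorem exists_isCutOff_of_cube {V I : Type*} [DecidableEq V] [Fintype I]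
    (G : SimpleGraph V) {Arc : V → V → Prop} [DecidableRel Arc]
    (hArc : ∀ v w, G.Adj v w → Arc v w ∨ Arc w v)
    (x : V → I → Bool) (hx : ∀ v w, Arc v w → hammingDist (x v) (x w) ≤ 1)
    (Y : Finset V) (hY : Y.Nonempty) {C r ℓ : ℕ} (hC : 0 < C) (hr : 0 < r)
    (hcard : ((Y ×ˢ Y).filter fun p => Arc p.1 p.2).card ≤ C * Y.card)
    (hpath : ∀ (a : I → Bool) (l : List V), l.Nodup → l.IsChain G.Adj →
      (∀ v ∈ l, hammingDist (x v) a ≤ 2 * r) → l.length ≤ ℓ)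
    (hℓr : ℓ * r ≤ C * Y.card) (hℓ : 10 * ℓ ≤ Y.card) :
    ∃ A S, IsCutOff G Y A S ∧ A.Nonempty ∧ S.card * r ≤ 10 * C * A.card := by
  classical
  set E := (Y ×ˢ Y).filter fun p => Arc p.1 p.2 with hE
  have hYpos := hY.card_pos
  have hmaj : ∀ k, ∃ b : Bool, 2 * (Y.filter fun v => x v k ≠ b).card ≤ Y.card := by
    intro k
    have h1 := Finset.card_filter_add_card_filter_not (s := Y) fun v => x v k = true
    by_cases h : 2 * (Y.filter fun v => x v k ≠ true).card ≤ Y.card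
    · exact ⟨true, h⟩
    · refine ⟨false, ?_⟩
      simp only [ne_eq, Bool.not_eq_false] at h ⊢
      omega
  choose a ha using hmaj
  by_cases hk : ∃ k, (Y.filter fun v => x v k ≠ a k).Nonempty ∧
      (E.filter fun p => x p.1 k ≠ x p.2 k).card * r ≤
        2 * C * (Y.filter fun v => x v k ≠ a k).card
  · obtain ⟨k, hne, hle⟩ := hk
    have hb := card_boundary_le hArc Y fun v => x v k ≠ a k
    refine ⟨_, Y.filter fun y => ¬ (x y k ≠ a k) ∧ ∃ z ∈ Y, x z k ≠ a k ∧ G.Adj z y,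
      ⟨Finset.filter_subset _ _, Finset.filter_subset _ _, ?_, ha k, ?_⟩, hne, ?_⟩
    · rw [Finset.disjoint_filter]
      tauto
    · intro z hz y hy hzy
      rw [Finset.mem_filter] at hz
      simp only [Finset.mem_filter]
      by_cases h : x y k ≠ a k
      · exact Or.inl ⟨hy, h⟩
      · exact Or.inr ⟨hy, h, z, hz.1, hz.2, hzy⟩
    · have heq : (E.filter fun p => ¬ (x p.1 k ≠ a k ↔ x p.2 k ≠ a k)) =
          E.filter fun p => x p.1 k ≠ x p.2 k := by
        refine Finset.filter_congr fun p _ => ?_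
        cases x p.1 k <;> cases x p.2 k <;> cases a k <;> simp
      rw [heq] at hb
      calc _ ≤ _ := Nat.mul_le_mul_right r hb
        _ ≤ _ := hle
        _ ≤ _ := by gcongr; norm_num
  · push Not at hk
    have hk' : ∀ k, 2 * C * (Y.filter fun v => x v k ≠ a k).card ≤
        (E.filter fun p => x p.1 k ≠ x p.2 k).card * r := by
      intro k
      by_cases hne : (Y.filter fun v => x v k ≠ a k).Nonempty
      · exact (hk k hne).le
      · rw [Finset.not_nonempty_iff_eq_empty] at hne
        simp [hne]
    have hsumE : ∑ k, (E.filter fun p => x p.1 k ≠ x p.2 k).card ≤ E.card := by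
      refine sum_card_filter_le E Finset.univ (fun p k => x p.1 k ≠ x p.2 k) fun p hp => ?_
      exact hx _ _ (Finset.mem_filter.1 hp).2
    have hsumA : ∑ k, (Y.filter fun v => x v k ≠ a k).card = ∑ v ∈ Y, hammingDist (x v) a := by
      have := Finset.sum_card_bipartiteAbove_eq_sum_card_bipartiteBelow (s := Y)
        (t := Finset.univ) fun v k => x v k ≠ a k
      exact this.symm
    have hsum : 2 * ∑ v ∈ Y, hammingDist (x v) a ≤ Y.card * r := by
      have h1 := Finset.sum_le_sum fun k (_ : k ∈ Finset.univ) => hk' k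
      rw [← Finset.mul_sum, ← Finset.sum_mul, hsumA] at h1
      have h2 := h1.trans (Nat.mul_le_mul_right r (hsumE.trans hcard))
      refine Nat.le_of_mul_le_mul_left ?_ hC
      linarith
    have hfar : 2 * (Y.filter fun v => ¬ hammingDist (x v) a ≤ r).card ≤ Y.card := by
      refine Nat.le_of_mul_le_mul_right (hsum.trans' ?_) hr
      rw [mul_assoc]
      refine Nat.mul_le_mul_left 2 ?_
      rw [← smul_eq_mul]
      refine (Finset.card_nsmul_le_sum _ (fun v => hammingDist (x v) a) r fun v hv => ?_).trans
        (Finset.sum_le_sum_of_subset (Finset.filter_subset _ _))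
      exact (not_le.1 (Finset.mem_filter.1 hv).2).le
    have hlayer : ∃ j ∈ Finset.Ico r (2 * r), (E.filter fun p =>
        ¬ (hammingDist (x p.1) a ≤ j ↔ hammingDist (x p.2) a ≤ j)).card * r ≤ C * Y.card := by
      by_contra hcon
      simp only [not_exists, not_and, not_le] at hcon
      have h1 := sum_card_filter_le E (Finset.Ico r (2 * r))
        (fun p j => ¬ (hammingDist (x p.1) a ≤ j ↔ hammingDist (x p.2) a ≤ j)) fun p hp => by
          have h1 := hx _ _ (Finset.mem_filter.1 hp).2
          have h2 := hammingDist_triangle (x p.1) (x p.2) a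
          have h3 := hammingDist_triangle_left (x p.2) a (x p.1)
          refine Finset.card_le_one.2 fun i hi j hj => ?_
          have hi := (Finset.mem_filter.1 hi).2
          have hj := (Finset.mem_filter.1 hj).2
          omega
      have h2 : ∑ j ∈ Finset.Ico r (2 * r), C * Y.card < ∑ j ∈ Finset.Ico r (2 * r),
          (E.filter fun p =>
            ¬ (hammingDist (x p.1) a ≤ j ↔ hammingDist (x p.2) a ≤ j)).card * r :=
        Finset.sum_lt_sum_of_nonempty (by simp; omega) hcon
      rw [Finset.sum_const, Nat.card_Ico, smul_eq_mul,
        show 2 * r - r = r by omega] at h2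
      have h3 := Nat.mul_le_mul_right r (h1.trans hcard)
      rw [Finset.sum_mul] at h3
      have h4 := h2.trans_le h3
      rw [mul_comm] at h4
      exact lt_irrefl _ h4
    obtain ⟨j, hj, hjE⟩ := hlayer
    rw [Finset.mem_Ico] at hj
    set Z := Y.filter fun v => hammingDist (x v) a ≤ j with hZ
    have hZY : Z ⊆ Y := Finset.filter_subset _ _
    have hZc : Y.card ≤ 2 * Z.card := by
      have h1 := Finset.card_filter_add_card_filter_not (s := Y) fun v => hammingDist (x v) a ≤ r
      have h2 : (Y.filter fun v => hammingDist (x v) a ≤ r).card ≤ Z.card :=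
        Finset.card_le_card (Finset.monotone_filter_right _ fun v _ hv => hv.trans hj.1)
      omega
    obtain ⟨A, S, hAS, hS, hA⟩ := exists_isCutOff_of_short_paths G Z ℓ fun l h1 h2 h3 =>
      hpath a l h1 h2 fun v hv => (Finset.mem_filter.1 (h3 v hv)).2.trans hj.2.le
    set S1 := Y.filter fun y => ¬ (hammingDist (x y) a ≤ j) ∧
      ∃ z ∈ Y, hammingDist (x z) a ≤ j ∧ G.Adj z y with hS1
    have hb : S1.card * r ≤ C * Y.card :=
      (Nat.mul_le_mul_right r (card_boundary_le hArc Y fun v => hammingDist (x v) a ≤ j)).trans hjE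
    have hA5 : Y.card ≤ 5 * A.card := by omega
    refine ⟨A, S ∪ S1, ⟨hAS.left_subset.trans hZY, Finset.union_subset
      (hAS.right_subset.trans hZY) (Finset.filter_subset _ _), ?_,
      hAS.two_mul_card_le.trans (Finset.card_le_card hZY), ?_⟩, ?_, ?_⟩
    · rw [Finset.disjoint_union_right]
      refine ⟨hAS.disjoint, Finset.disjoint_left.2 fun v hv hv1 => ?_⟩
      exact (Finset.mem_filter.1 hv1).2.1 (Finset.mem_filter.1 (hAS.left_subset hv)).2
    · intro z hz y hy hzy
      rw [Finset.mem_union]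
      have hzZ := Finset.mem_filter.1 (hAS.left_subset hz)
      by_cases hyj : hammingDist (x y) a ≤ j
      · have := hAS.mem_of_adj z hz y (Finset.mem_filter.2 ⟨hy, hyj⟩) hzy
        tauto
      · exact Or.inr (Or.inr (Finset.mem_filter.2 ⟨hy, hyj, z, hzZ.1, hzZ.2, hzy⟩))
    · exact Finset.card_pos.1 (by omega)
    · calc (S ∪ S1).card * r ≤ (S.card + S1.card) * r :=
          Nat.mul_le_mul_right r (Finset.card_union_le _ _)
        _ = S.card * r + S1.card * r := add_mul _ _ _
        _ ≤ ℓ * r + C * Y.card := add_le_add (Nat.mul_le_mul_right r hS) hb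
        _ ≤ 2 * C * Y.card := by linarith
        _ ≤ 2 * C * (5 * A.card) := Nat.mul_le_mul_left _ hA5
        _ = 10 * C * A.card := by ring

section RandomCube

/-- Change one coordinate of a point of the cube. -/
def flipAt {I : Type*} [DecidableEq I] (x : I → Bool) (i : I) : I → Bool :=
  Function.update x i (!x i)

theorem flipAt_flipAt {I : Type*} [DecidableEq I] (x : I → Bool) (i : I) :
    flipAt (flipAt x i) i = x := by
  simp [flipAt]

theorem flipAt_injective {I : Type*} [DecidableEq I] (x : I → Bool) :
    Function.Injective (flipAt x) := by
  intro i i' h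
  by_contra hne
  have := congrFun h i
  simp [flipAt, Function.update_of_ne hne] at this

theorem hammingDist_flipAt {I : Type*} [Fintype I] [DecidableEq I] (x : I → Bool) (i : I) :
    hammingDist x (flipAt x i) = 1 := by
  rw [hammingDist, Finset.card_eq_one]
  refine ⟨i, ?_⟩
  ext k
  rw [Finset.mem_filter, Finset.mem_singleton]
  by_cases h : k = i
  · subst h; simp [flipAt]
  · simp [flipAt, h]

theorem hammingDist_flipAt_of_ne {I : Type*} [Fintype I] [DecidableEq I] {x a : I → Bool} {i : I}
    (h : x i ≠ a i) : hammingDist (flipAt x i) a + 1 = hammingDist x a := by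
  have heq : (Finset.univ.filter fun k => flipAt x i k ≠ a k) =
      (Finset.univ.filter fun k => x k ≠ a k).erase i := by
    ext k
    rw [Finset.mem_erase, Finset.mem_filter, Finset.mem_filter]
    by_cases hk : k = i
    · subst hk
      revert h
      cases h1 : x k <;> cases a k <;> simp [flipAt, h1]
    · simp [flipAt, hk]
  rw [hammingDist, heq]
  exact Finset.card_erase_add_one (by simpa using h)

theorem hammingDist_flipAt_of_eq {I : Type*} [Fintype I] [DecidableEq I] {x a : I → Bool} {i : I}
    (h : x i = a i) : hammingDist (flipAt x i) a = hammingDist x a + 1 := by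
  have := hammingDist_flipAt_of_ne (x := flipAt x i) (a := a) (i := i) (by simp [flipAt, h])
  rw [flipAt_flipAt] at this
  exact this.symm

variable {J K U : Type*} [DecidableEq J] [DecidableEq K]

/-- The vertex reached from `v` by changing the coordinate `(j, p.1)` and moving to the copy `p.2`
of the cube. -/
def cubeStep (v : (J × K → Bool) × U) (j : J) (p : K × U) : (J × K → Bool) × U :=
  (flipAt v.1 (j, p.1), p.2)

theorem cubeStep_injective (v : (J × K → Bool) × U) :
    Function.Injective fun q : J × K × U => cubeStep v q.1 q.2 := by
  rintro ⟨j, k, u⟩ ⟨j', k', u'⟩ h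
  have h1 := flipAt_injective _ (congrArg Prod.fst h)
  have h2 := congrArg Prod.snd h
  simp_all [cubeStep]

theorem cubeStep_reverse (v : (J × K → Bool) × U) (j : J) (p : K × U) :
    cubeStep (cubeStep v j p) j (p.1, v.2) = v := by
  simp [cubeStep, flipAt_flipAt]

theorem cubeStep_ne (v : (J × K → Bool) × U) (j : J) (p : K × U) : cubeStep v j p ≠ v := by
  intro h
  have := congrFun (congrArg Prod.fst h) (j, p.1)
  simp [cubeStep, flipAt] at this

/-- The arcs of the graph in which every vertex `v` chooses for each class `j` of directions the
arc that is prescribed by `f (v, j)`. -/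
def CubeArc (f : ((J × K → Bool) × U) × J → K × U) (v w : (J × K → Bool) × U) : Prop :=
  ∃ j, cubeStep v j (f (v, j)) = w

/-- The undirected graph of the arcs prescribed by `f`. -/
def cubeGraph (f : ((J × K → Bool) × U) × J → K × U) : SimpleGraph ((J × K → Bool) × U) :=
  SimpleGraph.fromRel (CubeArc f)

/-- A set of prescribed values has the expected probability. -/
theorem card_filter_forall_mem_mul_le {α β : Type*} [Fintype α] [DecidableEq α] [Fintype β]
    [DecidableEq β] (T : Finset α) (W : α → Finset β) {w : ℕ} (hW : ∀ τ ∈ T, (W τ).card ≤ w) :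
    (Finset.univ.filter fun f : α → β => ∀ τ ∈ T, f τ ∈ W τ).card * Fintype.card β ^ T.card ≤
      w ^ T.card * Fintype.card (α → β) := by
  have heq : (Finset.univ.filter fun f : α → β => ∀ τ ∈ T, f τ ∈ W τ) =
      Fintype.piFinset fun τ => if τ ∈ T then W τ else Finset.univ := by
    ext f
    simp only [Finset.mem_filter, Finset.mem_univ, true_and, Fintype.mem_piFinset]
    refine forall_congr' fun τ => ?_
    by_cases h : τ ∈ T <;> simp [h]
  rw [heq, Fintype.card_piFinset]
  have h1 : ∏ τ, (if τ ∈ T then W τ else (Finset.univ : Finset β)).card ≤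
      ∏ τ, if τ ∈ T then w else Fintype.card β := by
    refine Finset.prod_le_prod' fun τ _ => ?_
    by_cases h : τ ∈ T
    · simpa [h] using hW τ h
    · simp [h]
  have h2 : (∏ τ, if τ ∈ T then w else Fintype.card β) =
      w ^ T.card * Fintype.card β ^ (Tᶜ).card := by
    rw [Finset.prod_ite]
    simp [Finset.filter_not, Finset.compl_eq_univ_sdiff]
  rw [h2] at h1
  calc _ ≤ _ := Nat.mul_le_mul_right _ h1
    _ = _ := by
      rw [mul_assoc, ← pow_add, add_comm, Finset.card_add_card_compl, Fintype.card_fun]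

theorem card_filter_forall_eq_mul_le {α β : Type*} [Fintype α] [DecidableEq α] [Fintype β]
    [DecidableEq β] (c : Finset (α × β)) :
    (Finset.univ.filter fun f : α → β => ∀ p ∈ c, f p.1 = p.2).card * Fintype.card β ^ c.card ≤
      Fintype.card (α → β) := by
  by_cases hinj : Set.InjOn Prod.fst (c : Set (α × β))
  · have := card_filter_forall_mem_mul_le (c.image Prod.fst)
      (fun τ => (c.filter fun p => p.1 = τ).image Prod.snd) (w := 1) fun τ _ => by
        refine Finset.card_image_le.trans (Finset.card_le_one.2 fun p hp q hq => ?_)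
        rw [Finset.mem_filter] at hp hq
        exact hinj hp.1 hq.1 (hp.2.trans hq.2.symm)
    rw [Finset.card_image_of_injOn hinj, one_pow, one_mul] at this
    refine le_trans (Nat.mul_le_mul_right _ (Finset.card_le_card ?_)) this
    refine Finset.monotone_filter_right _ fun f _ hf τ hτ => ?_
    obtain ⟨p, hp, rfl⟩ := Finset.mem_image.1 hτ
    exact Finset.mem_image.2 ⟨p, Finset.mem_filter.2 ⟨hp, rfl⟩, (hf p hp).symm⟩
  · have : (Finset.univ.filter fun f : α → β => ∀ p ∈ c, f p.1 = p.2) = ∅ := by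
      rw [Finset.filter_eq_empty_iff]
      intro f _ hf
      refine hinj fun p hp q hq hpq => Prod.ext hpq ?_
      rw [← hf p hp, ← hf q hq, hpq]
    rw [this, Finset.card_empty, zero_mul]
    exact Nat.zero_le _

theorem card_filter_mul_le_of_cover {α β : Type*} [Fintype α] [DecidableEq α] [Fintype β]
    [DecidableEq β] (P : (α → β) → Prop) [DecidablePred P] (F : Finset (Finset (α × β))) (e : ℕ)
    (he : ∀ c ∈ F, c.card = e) (h : ∀ f, P f → ∃ c ∈ F, ∀ p ∈ c, f p.1 = p.2) :
    (Finset.univ.filter P).card * Fintype.card β ^ e ≤ F.card * Fintype.card (α → β) := by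
  have hsub : Finset.univ.filter P ⊆
      F.biUnion fun c => Finset.univ.filter fun f => ∀ p ∈ c, f p.1 = p.2 := by
    intro f hf
    obtain ⟨c, hc, hfc⟩ := h f (Finset.mem_filter.1 hf).2
    exact Finset.mem_biUnion.2 ⟨c, hc, Finset.mem_filter.2 ⟨Finset.mem_univ _, hfc⟩⟩
  refine (Nat.mul_le_mul_right _ ((Finset.card_le_card hsub).trans Finset.card_biUnion_le)).trans ?_
  rw [Finset.sum_mul]
  refine (Finset.sum_le_card_nsmul _ _ _ fun c hc => ?_).trans_eq (smul_eq_mul _ _)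
  rw [← he c hc]
  exact card_filter_forall_eq_mul_le c

/-- The event that a given sequence of distinct vertices is a path is covered by events that
prescribe the values of `f` at as many places as the path has edges. -/
theorem exists_cover_isChain_cubeGraph [DecidableEq U] (l : List ((J × K → Bool) × U))
    (hl : l.Nodup) :
    ∃ F : Finset (Finset ((((J × K → Bool) × U) × J) × (K × U))),
      F.card ≤ 2 ^ (l.length - 1) ∧
      (∀ c ∈ F, c.card = l.length - 1 ∧
        ∀ p ∈ c, p.1.1 ∈ l ∧ cubeStep p.1.1 p.1.2 p.2 ∈ l) ∧
      ∀ f : ((J × K → Bool) × U) × J → K × U, l.IsChain (cubeGraph f).Adj →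
        ∃ c ∈ F, ∀ p ∈ c, f p.1 = p.2 := by
  classical
  induction l with
  | nil => exact ⟨{∅}, by simp⟩
  | cons u l ih =>
    match l, ih with
    | [], _ => exact ⟨{∅}, by simp⟩
    | w :: l, ih =>
      obtain ⟨hu, hl'⟩ := List.nodup_cons.1 hl
      obtain ⟨F, hF1, hF2, hF3⟩ := ih hl'
      by_cases hstep : ∃ j p, cubeStep u j p = w
      · obtain ⟨j, p, hw⟩ := hstep
        have hrev : cubeStep w j (p.1, u.2) = u := by rw [← hw, cubeStep_reverse]
        refine ⟨F.image (insert ((u, j), p)) ∪ F.image (insert ((w, j), (p.1, u.2))), ?_, ?_, ?_⟩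
        · refine (Finset.card_union_le _ _).trans ?_
          refine (add_le_add Finset.card_image_le Finset.card_image_le).trans ?_
          simp only [List.length_cons, Nat.add_sub_cancel] at hF1 ⊢
          rw [pow_succ]
          omega
        · intro c hc
          simp only [List.length_cons, Nat.add_sub_cancel] at hF2 ⊢
          rw [Finset.mem_union, Finset.mem_image, Finset.mem_image] at hc
          rcases hc with ⟨c, hc, rfl⟩ | ⟨c, hc, rfl⟩
          · refine ⟨?_, fun q hq => ?_⟩
            · rw [Finset.card_insert_of_notMem fun h => hu ((hF2 c hc).2 _ h).1, (hF2 c hc).1]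
            · rcases Finset.mem_insert.1 hq with rfl | hq
              · simp [hw]
              · have := (hF2 c hc).2 q hq
                exact ⟨List.mem_cons_of_mem _ this.1, List.mem_cons_of_mem _ this.2⟩
          · refine ⟨?_, fun q hq => ?_⟩
            · rw [Finset.card_insert_of_notMem, (hF2 c hc).1]
              intro h
              have := ((hF2 c hc).2 _ h).2
              rw [hrev] at this
              exact hu this
            · rcases Finset.mem_insert.1 hq with rfl | hq
              · simp [hrev]
              · have := (hF2 c hc).2 q hq
                exact ⟨List.mem_cons_of_mem _ this.1, List.mem_cons_of_mem _ this.2⟩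
        · intro f hf
          rw [List.isChain_cons_cons] at hf
          obtain ⟨c, hc, hfc⟩ := hF3 f hf.2
          rcases (SimpleGraph.fromRel_adj _ _ _).1 hf.1 with ⟨_, ⟨j', h⟩ | ⟨j', h⟩⟩
          · have h1 := cubeStep_injective u (a₁ := (j', f (u, j'))) (a₂ := (j, p)) (h.trans hw.symm)
            obtain ⟨rfl, h2⟩ := Prod.mk.inj h1
            refine ⟨insert ((u, j'), p) c, Finset.mem_union_left _ (Finset.mem_image_of_mem _ hc), ?_⟩
            intro q hq
            rcases Finset.mem_insert.1 hq with rfl | hq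
            · exact h2
            · exact hfc q hq
          · have h1 := cubeStep_injective w (a₁ := (j', f (w, j'))) (a₂ := (j, (p.1, u.2)))
              (h.trans hrev.symm)
            obtain ⟨rfl, h2⟩ := Prod.mk.inj h1
            refine ⟨insert ((w, j'), (p.1, u.2)) c,
              Finset.mem_union_right _ (Finset.mem_image_of_mem _ hc), ?_⟩
            intro q hq
            rcases Finset.mem_insert.1 hq with rfl | hq
            · exact h2
            · exact hfc q hq
      · refine ⟨∅, by simp, by simp, fun f hf => absurd ?_ hstep⟩
        rw [List.isChain_cons_cons] at hf
        rcases (SimpleGraph.fromRel_adj _ _ _).1 hf.1 with ⟨_, ⟨j, h⟩ | ⟨j, h⟩⟩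
        · exact ⟨j, _, h⟩
        · exact ⟨j, _, by rw [← h, cubeStep_reverse]⟩

theorem card_filter_isChain_cubeGraph_mul_le [DecidableEq U] [Fintype J] [Fintype K] [Fintype U]
    (l : List ((J × K → Bool) × U)) (hl : l.Nodup)
    [DecidablePred fun f : ((J × K → Bool) × U) × J → K × U => l.IsChain (cubeGraph f).Adj] :
    (Finset.univ.filter fun f : ((J × K → Bool) × U) × J → K × U =>
      l.IsChain (cubeGraph f).Adj).card * Fintype.card (K × U) ^ (l.length - 1) ≤
      2 ^ (l.length - 1) * Fintype.card (((J × K → Bool) × U) × J → K × U) := by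
  obtain ⟨F, hF1, hF2, hF3⟩ := exists_cover_isChain_cubeGraph l hl
  exact (card_filter_mul_le_of_cover _ F _ (fun c hc => (hF2 c hc).1) hF3).trans
    (Nat.mul_le_mul_right _ hF1)

end RandomCube

/-- The walks with `n` edges that start at `u` and whose other vertices are at distance at most `R`
from `a` in the cube. -/
def ballWalks {I U : Type*} [Fintype I] [DecidableEq I] [Fintype U] [DecidableEq U]
    (a : I → Bool) (R : ℕ) : ℕ → (I → Bool) × U → Finset (List ((I → Bool) × U))
  | 0, u => {[u]}
  | n + 1, u => (Finset.univ : Finset (I × U)).biUnion fun q =>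
      if hammingDist (flipAt u.1 q.1) a ≤ R then
        (ballWalks a R n (flipAt u.1 q.1, q.2)).image (List.cons u) else ∅

theorem mem_ballWalks {I U : Type*} [Fintype I] [DecidableEq I] [Fintype U] [DecidableEq U]
    {a : I → Bool} {R n : ℕ} {u : (I → Bool) × U} {l : List ((I → Bool) × U)}
    (hl : (u :: l).IsChain fun v w => ∃ i, w.1 = flipAt v.1 i)
    (hR : ∀ v ∈ l, hammingDist v.1 a ≤ R) (hn : l.length = n) : u :: l ∈ ballWalks a R n u := by
  induction n generalizing u l with
  | zero => simp [List.length_eq_zero_iff.1 hn, ballWalks]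
  | succ n ih =>
    match l with
    | [] => simp at hn
    | w :: l =>
      rw [List.isChain_cons_cons] at hl
      obtain ⟨⟨i, hi⟩, hl⟩ := hl
      have hw : hammingDist (flipAt u.1 i) a ≤ R := hi ▸ hR w (by simp)
      rw [ballWalks, Finset.mem_biUnion]
      refine ⟨(i, w.2), Finset.mem_univ _, ?_⟩
      rw [if_pos hw, ← hi]
      exact Finset.mem_image_of_mem _ (ih hl (fun v hv => hR v (by simp [hv])) (by simpa using hn))

theorem pow_mul_card_ballWalks_le {I U : Type*} [Fintype I] [DecidableEq I] [Fintype U]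
    [DecidableEq U] (a : I → Bool) {R κ : ℕ} (hκ0 : 0 < κ) (hκ : R * κ ^ 2 ≤ Fintype.card I) (n : ℕ)
    (u : (I → Bool) × U) (hu : hammingDist u.1 a ≤ R) :
    κ ^ n * (ballWalks a R n u).card ≤
      (2 * Fintype.card I * Fintype.card U) ^ n * κ ^ (R - hammingDist u.1 a) := by
  induction n generalizing u with
  | zero =>
    rw [ballWalks, Finset.card_singleton, pow_zero, pow_zero, one_mul, one_mul]
    exact Nat.one_le_pow _ _ hκ0
  | succ n ih =>
    set d := hammingDist u.1 a with hd
    have hterm : ∀ i, (if hammingDist (flipAt u.1 i) a ≤ R then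
        κ * κ ^ (R - hammingDist (flipAt u.1 i) a) else 0) ≤
        κ ^ (R - d) + if u.1 i ≠ a i then κ ^ 2 * κ ^ (R - d) else 0 := by
      intro i
      split_ifs with h1 h2 h2
      · have := hammingDist_flipAt_of_ne h2
        rw [show R - hammingDist (flipAt u.1 i) a = (R - d) + 1 by omega, pow_succ]
        refine le_trans (le_of_eq (by ring)) (Nat.le_add_left _ _)
      · have := hammingDist_flipAt_of_eq (not_not.1 h2)
        rw [← pow_succ', add_zero,
          show R - hammingDist (flipAt u.1 i) a + 1 = R - d by omega]
      · exact Nat.zero_le _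
      · exact Nat.zero_le _
    have hsum : ∑ i, (if hammingDist (flipAt u.1 i) a ≤ R then
        κ * κ ^ (R - hammingDist (flipAt u.1 i) a) else 0) ≤
        2 * Fintype.card I * κ ^ (R - d) := by
      refine (Finset.sum_le_sum fun i _ => hterm i).trans ?_
      rw [Finset.sum_add_distrib, ← Finset.sum_filter, Finset.sum_const, Finset.sum_const,
        smul_eq_mul, smul_eq_mul, Finset.card_univ, ← mul_assoc]
      change _ + d * κ ^ 2 * _ ≤ _
      have : d * κ ^ 2 ≤ Fintype.card I := (Nat.mul_le_mul_right _ hu).trans hκ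
      rw [← add_mul]
      gcongr
      omega
    have hcard : (ballWalks a R (n + 1) u).card ≤ ∑ q : I × U,
        if hammingDist (flipAt u.1 q.1) a ≤ R then
          (ballWalks a R n (flipAt u.1 q.1, q.2)).card else 0 := by
      rw [ballWalks]
      refine Finset.card_biUnion_le.trans (Finset.sum_le_sum fun q _ => ?_)
      split_ifs
      · exact Finset.card_image_le
      · simp
    calc κ ^ (n + 1) * (ballWalks a R (n + 1) u).card
        ≤ κ ^ (n + 1) * ∑ q : I × U, if hammingDist (flipAt u.1 q.1) a ≤ R then
          (ballWalks a R n (flipAt u.1 q.1, q.2)).card else 0 := Nat.mul_le_mul_left _ hcard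
      _ ≤ ∑ q : I × U, (2 * Fintype.card I * Fintype.card U) ^ n *
          if hammingDist (flipAt u.1 q.1) a ≤ R then
            κ * κ ^ (R - hammingDist (flipAt u.1 q.1) a) else 0 := by
        rw [Finset.mul_sum]
        refine Finset.sum_le_sum fun q _ => ?_
        split_ifs with h
        · have := Nat.mul_le_mul_left κ (ih (flipAt u.1 q.1, q.2) h)
          calc _ = _ := by rw [pow_succ', mul_assoc]
            _ ≤ _ := this
            _ = _ := by ring
        · simp
      _ = (2 * Fintype.card I * Fintype.card U) ^ n * (Fintype.card U *
          ∑ i, if hammingDist (flipAt u.1 i) a ≤ R then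
            κ * κ ^ (R - hammingDist (flipAt u.1 i) a) else 0) := by
        rw [← Finset.mul_sum, Fintype.sum_prod_type]
        simp [Finset.mul_sum]
      _ ≤ (2 * Fintype.card I * Fintype.card U) ^ n * (Fintype.card U *
          (2 * Fintype.card I * κ ^ (R - d))) := by gcongr
      _ = _ := by ring

theorem card_filter_exists_mem_mul_le {Ω ι : Type*} [Fintype Ω] (L : Finset ι)
    (P : ι → Ω → Prop) [∀ i, DecidablePred (P i)] [DecidablePred fun ω => ∃ i ∈ L, P i ω]
    {b c : ℕ} (h : ∀ i ∈ L, (Finset.univ.filter (P i)).card * b ≤ c) :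
    (Finset.univ.filter fun ω => ∃ i ∈ L, P i ω).card * b ≤ L.card * c := by
  classical
  have hsub : (Finset.univ.filter fun ω => ∃ i ∈ L, P i ω) ⊆
      L.biUnion fun i => Finset.univ.filter (P i) := by
    intro ω hω
    obtain ⟨i, hi, hP⟩ := (Finset.mem_filter.1 hω).2
    exact Finset.mem_biUnion.2 ⟨i, hi, Finset.mem_filter.2 ⟨Finset.mem_univ _, hP⟩⟩
  refine (Nat.mul_le_mul_right _ ((Finset.card_le_card hsub).trans Finset.card_biUnion_le)).trans ?_
  rw [Finset.sum_mul]
  exact (Finset.sum_le_card_nsmul _ _ _ h).trans_eq (smul_eq_mul _ _)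

theorem isChain_flipAt_of_isChain_cubeGraph {J K U : Type*} [DecidableEq J] [DecidableEq K]
    {f : ((J × K → Bool) × U) × J → K × U} {l : List ((J × K → Bool) × U)}
    (hl : l.IsChain (cubeGraph f).Adj) : l.IsChain fun v w => ∃ i, w.1 = flipAt v.1 i := by
  refine hl.imp fun v w h => ?_
  rcases (SimpleGraph.fromRel_adj _ _ _).1 h with ⟨_, ⟨j, h⟩ | ⟨j, h⟩⟩
  · exact ⟨(j, _), by rw [← h, cubeStep]⟩
  · exact ⟨(j, (f (w, j)).1), by rw [← h, cubeStep, flipAt_flipAt]⟩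

open Classical in
/-- Few choices of `f` lead to a path with `ℓ` edges in a Hamming ball of radius `R`. -/
theorem card_filter_exists_path_mul_le {J K U : Type*} [DecidableEq J] [DecidableEq K]
    [DecidableEq U] [Fintype J] [Fintype K] [Fintype U] {R κ : ℕ} (ℓ : ℕ) (hκ0 : 0 < κ)
    (hκ : R * κ ^ 2 ≤ Fintype.card (J × K)) :
    (Finset.univ.filter fun f : ((J × K → Bool) × U) × J → K × U =>
      ∃ (a : J × K → Bool) (l : List ((J × K → Bool) × U)), l.Nodup ∧
        l.IsChain (cubeGraph f).Adj ∧ (∀ v ∈ l, hammingDist v.1 a ≤ R) ∧ l.length = ℓ + 1).card *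
      (κ * Fintype.card (K × U)) ^ ℓ ≤
    Fintype.card (J × K → Bool) * Fintype.card ((J × K → Bool) × U) * κ ^ R *
      (4 * Fintype.card (J × K) * Fintype.card U) ^ ℓ *
      Fintype.card (((J × K → Bool) × U) × J → K × U) := by
  set all := Fintype.card (((J × K → Bool) × U) × J → K × U)
  have key : ∀ p : (J × K → Bool) × ((J × K → Bool) × U),
      (Finset.univ.filter fun f : ((J × K → Bool) × U) × J → K × U =>
        ∃ l ∈ (if hammingDist p.2.1 p.1 ≤ R then (ballWalks p.1 R ℓ p.2).filter
          fun l => l.Nodup ∧ l.length = ℓ + 1 else ∅), l.IsChain (cubeGraph f).Adj).card *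
        (κ * Fintype.card (K × U)) ^ ℓ ≤
        κ ^ R * (4 * Fintype.card (J × K) * Fintype.card U) ^ ℓ * all := by
    rintro ⟨a, u⟩
    have h1 := card_filter_exists_mem_mul_le (if hammingDist u.1 a ≤ R then
      (ballWalks a R ℓ u).filter fun l => l.Nodup ∧ l.length = ℓ + 1 else ∅)
      (fun l (f : ((J × K → Bool) × U) × J → K × U) => l.IsChain (cubeGraph f).Adj)
      (b := Fintype.card (K × U) ^ ℓ) (c := 2 ^ ℓ * all) fun l hl => by
        split_ifs at hl with h
        · obtain ⟨_, hl1, hl2⟩ := Finset.mem_filter.1 hl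
          have := card_filter_isChain_cubeGraph_mul_le l hl1
          rwa [hl2, Nat.add_sub_cancel] at this
        · simp at hl
    have h2 : κ ^ ℓ * (if hammingDist u.1 a ≤ R then
        (ballWalks a R ℓ u).filter fun l => l.Nodup ∧ l.length = ℓ + 1 else ∅).card ≤
        (2 * Fintype.card (J × K) * Fintype.card U) ^ ℓ * κ ^ R := by
      split_ifs with h
      · refine (Nat.mul_le_mul_left _ (Finset.card_filter_le _ _)).trans ?_
        refine (pow_mul_card_ballWalks_le a hκ0 hκ ℓ u h).trans ?_
        gcongr
        exact Nat.sub_le _ _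
      · simp
    rw [mul_pow κ, mul_comm (κ ^ ℓ), ← mul_assoc]
    refine (Nat.mul_le_mul_right _ h1).trans ?_
    calc _ = (κ ^ ℓ * (if hammingDist u.1 a ≤ R then
        (ballWalks a R ℓ u).filter fun l => l.Nodup ∧ l.length = ℓ + 1 else ∅).card) *
          (2 ^ ℓ * all) := by ring
      _ ≤ _ := Nat.mul_le_mul_right _ h2
      _ = _ := by
        rw [show 4 * Fintype.card (J × K) * Fintype.card U =
          2 * (2 * Fintype.card (J × K) * Fintype.card U) by ring, mul_pow 2 (2 * _ * _)]
        ring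
  have h := card_filter_exists_mem_mul_le
    (Finset.univ : Finset ((J × K → Bool) × ((J × K → Bool) × U))) _ fun p _ => key p
  rw [Finset.card_univ, Fintype.card_prod (J × K → Bool) ((J × K → Bool) × U), ← mul_assoc,
    ← mul_assoc] at h
  refine le_trans (Nat.mul_le_mul_right _ (Finset.card_le_card ?_)) h
  refine Finset.monotone_filter_right _ ?_
  rintro f _ ⟨a, l, h1, h2, h3, h4⟩
  match l with
  | [] => simp at h4
  | u :: l =>
    refine ⟨(a, u), Finset.mem_univ _, u :: l, ?_, h2⟩
    rw [if_pos (h3 u (by simp)), Finset.mem_filter]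
    exact ⟨mem_ballWalks (isChain_flipAt_of_isChain_cubeGraph h2)
      (fun v hv => h3 v (by simp [hv])) (by simpa using h4), h1, h4⟩

theorem card_filter_cubeStep_mem_le {J K U : Type*} [DecidableEq J] [DecidableEq K]
    [DecidableEq U] [Fintype J] [Fintype K] [Fintype U]
    (Y : Finset ((J × K → Bool) × U)) (v : (J × K → Bool) × U) (j : J) :
    (Finset.univ.filter fun p : K × U => cubeStep v j p ∈ Y).card ≤ Y.card := by
  refine Finset.card_le_card_of_injOn (cubeStep v j)
    (fun p hp => by simpa using hp) fun p _ q _ h => ?_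
  exact (Prod.mk.inj (cubeStep_injective v (a₁ := (j, p)) (a₂ := (j, q)) h)).2

open Classical in
/-- Few choices of `f` lead to a set of `m` vertices with more than `e` arcs. -/
theorem card_filter_exists_dense_mul_le {J K U : Type*} [DecidableEq J] [DecidableEq K]
    [DecidableEq U] [Fintype J] [Fintype K] [Fintype U] (m e : ℕ) :
    (Finset.univ.filter fun f : ((J × K → Bool) × U) × J → K × U =>
      ∃ Y ∈ Finset.powersetCard m (Finset.univ : Finset ((J × K → Bool) × U)),
        e ≤ ((Y ×ˢ Finset.univ).filter fun τ => cubeStep τ.1 τ.2 (f τ) ∈ Y).card).card *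
      Fintype.card (K × U) ^ e ≤
    Fintype.card ((J × K → Bool) × U) ^ m * (2 ^ (m * Fintype.card J) * (m ^ e *
      Fintype.card (((J × K → Bool) × U) × J → K × U))) := by
  set all := Fintype.card (((J × K → Bool) × U) × J → K × U)
  have key : ∀ Y ∈ Finset.powersetCard m (Finset.univ : Finset ((J × K → Bool) × U)),
      (Finset.univ.filter fun f : ((J × K → Bool) × U) × J → K × U =>
        ∃ T ∈ Finset.powersetCard e (Y ×ˢ (Finset.univ : Finset J)),
          ∀ τ ∈ T, f τ ∈ Finset.univ.filter fun p => cubeStep τ.1 τ.2 p ∈ Y).card *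
        Fintype.card (K × U) ^ e ≤ 2 ^ (m * Fintype.card J) * (m ^ e * all) := by
    intro Y hY
    have hYc := (Finset.mem_powersetCard.1 hY).2
    refine (card_filter_exists_mem_mul_le (c := m ^ e * all) _ _ fun T hT => ?_).trans ?_
    · have h := card_filter_forall_mem_mul_le T
        (fun τ : ((J × K → Bool) × U) × J => Finset.univ.filter fun p : K × U =>
          cubeStep τ.1 τ.2 p ∈ Y) (w := m) fun τ _ =>
            (card_filter_cubeStep_mem_le Y τ.1 τ.2).trans hYc.le
      rw [(Finset.mem_powersetCard.1 hT).2] at h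
      convert h
    · refine Nat.mul_le_mul_right _ ?_
      refine (Finset.card_le_card
        (fun T hT => Finset.mem_powerset.2 (Finset.mem_powersetCard.1 hT).1)).trans ?_
      rw [Finset.card_powerset, Finset.card_product, hYc, Finset.card_univ]
  have h := card_filter_exists_mem_mul_le
    (Finset.powersetCard m (Finset.univ : Finset ((J × K → Bool) × U))) _ key
  refine le_trans (Nat.mul_le_mul_right _ (Finset.card_le_card ?_))
    (h.trans (Nat.mul_le_mul_right _ ?_))
  · refine Finset.monotone_filter_right _ ?_
    rintro f _ ⟨Y, hY, he⟩
    obtain ⟨T, hT, hTc⟩ := Finset.exists_subset_card_eq he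
    refine ⟨Y, hY, T, Finset.mem_powersetCard.2
      ⟨hT.trans (Finset.filter_subset _ _), hTc⟩, fun τ hτ => ?_⟩
    simpa using (Finset.mem_filter.1 (hT hτ)).2
  · rw [Finset.card_powersetCard, Finset.card_univ]
    exact Nat.choose_le_pow _ _

theorem card_arcs_le_card_slots {J K U : Type*} [DecidableEq J] [DecidableEq K] [DecidableEq U]
    [Fintype J] [Fintype K] (f : ((J × K → Bool) × U) × J → K × U) [DecidableRel (CubeArc f)]
    (Y : Finset ((J × K → Bool) × U)) :
    ((Y ×ˢ Y).filter fun p => CubeArc f p.1 p.2).card ≤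
      ((Y ×ˢ Finset.univ).filter fun τ => cubeStep τ.1 τ.2 (f τ) ∈ Y).card := by
  refine le_trans (Finset.card_le_card ?_)
    (Finset.card_image_le (f := fun τ : ((J × K → Bool) × U) × J => (τ.1, cubeStep τ.1 τ.2 (f τ))))
  rintro ⟨v, w⟩ h
  simp only [Finset.mem_filter, Finset.mem_product] at h
  obtain ⟨⟨hv, hw⟩, j, hj⟩ := h
  exact Finset.mem_image.2 ⟨(v, j), by simp [hv, hj, hw], by simp [hj]⟩

theorem exists_not_and_not_of_card_le {Ω : Type*} [Fintype Ω] [Nonempty Ω] (P Q : Ω → Prop)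
    [DecidablePred P] [DecidablePred Q] (hP : 3 * (Finset.univ.filter P).card ≤ Fintype.card Ω)
    (hQ : 3 * (Finset.univ.filter Q).card ≤ Fintype.card Ω) : ∃ ω, ¬ P ω ∧ ¬ Q ω := by
  by_contra! hcon
  have h1 := Finset.card_filter_add_card_filter_not (s := (Finset.univ : Finset Ω)) P
  have h2 : (Finset.univ.filter fun ω => ¬ P ω).card ≤ (Finset.univ.filter Q).card :=
    Finset.card_le_card (Finset.monotone_filter_right _ fun ω _ => hcon ω)
  rw [Finset.card_univ] at h1
  have : 0 < Fintype.card Ω := Fintype.card_pos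
  omega

open Classical in
/-- For suitable parameters there is a random-like choice of arcs for which small sets of vertices
span few arcs and there are no long paths in Hamming balls. -/
theorem exists_cubeGraph {J K U : Type*} [DecidableEq J] [DecidableEq K] [DecidableEq U]
    [Fintype J] [Fintype K] [Fintype U] {n q : ℕ} [Nonempty K] [Nonempty U]
    (hn : Fintype.card ((J × K → Bool) × U) = n) (hq : Fintype.card (K × U) = q)
    {R κ ℓ D M : ℕ} (hM0 : 0 < M) (hκ0 : 0 < κ)
    (hκ : R * κ ^ 2 ≤ Fintype.card (J × K))
    (hℓ : 3 * (Fintype.card (J × K → Bool) * n * κ ^ R * (4 * Fintype.card J) ^ ℓ) ≤ κ ^ ℓ)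
    (hM : ∀ m, 1 ≤ m → m ≤ M → 3 * M * (n ^ m * 2 ^ (m * Fintype.card J) * m ^ (m + m / D + 1)) ≤
      q ^ (m + m / D + 1)) :
    ∃ f : ((J × K → Bool) × U) × J → K × U,
      (∀ (a : J × K → Bool) (l : List ((J × K → Bool) × U)), l.Nodup →
        l.IsChain (cubeGraph f).Adj → (∀ v ∈ l, hammingDist v.1 a ≤ R) → l.length ≤ ℓ) ∧
      ∀ Y : Finset ((J × K → Bool) × U), Y.Nonempty → Y.card ≤ M →
        D * ((Y ×ˢ Y).filter fun p => CubeArc f p.1 p.2).card ≤ (D + 1) * Y.card := by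
  set all := Fintype.card (((J × K → Bool) × U) × J → K × U) with hall
  have hall0 : 0 < all := Fintype.card_pos
  have hq0 : 0 < q := hq ▸ Fintype.card_pos
  let bad1 : (((J × K → Bool) × U) × J → K × U) → Prop := fun f =>
      ∃ (a : J × K → Bool) (l : List ((J × K → Bool) × U)), l.Nodup ∧
        l.IsChain (cubeGraph f).Adj ∧ (∀ v ∈ l, hammingDist v.1 a ≤ R) ∧ l.length = ℓ + 1
  let bad2 : (((J × K → Bool) × U) × J → K × U) → Prop := fun f => ∃ m ∈ Finset.Icc 1 M,
        ∃ Y ∈ Finset.powersetCard m (Finset.univ : Finset ((J × K → Bool) × U)),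
        m + m / D + 1 ≤ ((Y ×ˢ Finset.univ).filter fun τ => cubeStep τ.1 τ.2 (f τ) ∈ Y).card
  have h1 : 3 * (Finset.univ.filter bad1).card ≤ all := by
    have h := card_filter_exists_path_mul_le (J := J) (K := K) (U := U) ℓ hκ0 hκ
    rw [hn, hq, Fintype.card_prod J K] at h
    have h4 : 4 * (Fintype.card J * Fintype.card K) * Fintype.card U =
        4 * Fintype.card J * q := by
      rw [← hq, Fintype.card_prod]; ring
    rw [h4, mul_pow, mul_pow _ q] at h
    refine Nat.le_of_mul_le_mul_right ?_ (pow_pos hκ0 ℓ)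
    refine Nat.le_of_mul_le_mul_right ?_ (pow_pos hq0 ℓ)
    calc 3 * (Finset.univ.filter bad1).card * κ ^ ℓ * q ^ ℓ =
          3 * ((Finset.univ.filter bad1).card * (κ ^ ℓ * q ^ ℓ)) := by ring
      _ ≤ 3 * _ := Nat.mul_le_mul_left 3 h
      _ = 3 * (Fintype.card (J × K → Bool) * n * κ ^ R * (4 * Fintype.card J) ^ ℓ) *
          (all * q ^ ℓ) := by ring
      _ ≤ κ ^ ℓ * (all * q ^ ℓ) := Nat.mul_le_mul_right _ hℓ
      _ = _ := by ring
  have h2 : (Finset.univ.filter bad2).card * (3 * M) ≤ M * all := by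
    refine (card_filter_exists_mem_mul_le (Finset.Icc 1 M) _ fun m hm => ?_).trans_eq
      (congrArg (· * all) (Nat.card_Icc 1 M))
    rw [Finset.mem_Icc] at hm
    have h := card_filter_exists_dense_mul_le (J := J) (K := K) (U := U) m (m + m / D + 1)
    rw [hn, hq] at h
    refine Nat.le_of_mul_le_mul_right ?_ (pow_pos hq0 (m + m / D + 1))
    rw [mul_right_comm]
    refine (Nat.mul_le_mul_right _ h).trans ?_
    refine le_trans (le_of_eq ?_) ((Nat.mul_le_mul_right all (hM m hm.1 hm.2)).trans_eq
      (mul_comm _ _))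
    ring
  have h3 : 3 * (Finset.univ.filter bad2).card ≤ all := by
    refine Nat.le_of_mul_le_mul_right ?_ hM0
    linarith
  obtain ⟨f, hf⟩ := exists_not_and_not_of_card_le bad1 bad2 h1 h3
  refine ⟨f, fun a l hl hch hR => ?_, fun Y hY hYM => ?_⟩
  · by_contra! hlen
    refine hf.1 ⟨a, l.take (ℓ + 1), ?_, ?_, ?_, ?_⟩
    · exact hl.sublist (List.take_sublist _ _)
    · exact hch.take _
    · exact fun v hv => hR v (List.mem_of_mem_take hv)
    · rw [List.length_take]; omega
  · by_contra! hlt'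
    refine hf.2 ⟨Y.card, Finset.mem_Icc.2 ⟨hY.card_pos, hYM⟩, Y, by simp, ?_⟩
    refine le_trans ?_ (card_arcs_le_card_slots f Y)
    by_contra! hlt''
    have h3 : D * ((Y ×ˢ Y).filter fun p => CubeArc f p.1 p.2).card ≤
        D * (Y.card + Y.card / D) := Nat.mul_le_mul_left _ (by omega)
    have h4 := Nat.mul_div_le Y.card D
    rw [mul_add] at h3
    rw [add_mul, one_mul] at hlt'
    omega

theorem cubeArc_of_adj {J K U : Type*} [DecidableEq J] [DecidableEq K]
    {f : ((J × K → Bool) × U) × J → K × U} (v w : (J × K → Bool) × U)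
    (h : (cubeGraph f).Adj v w) : CubeArc f v w ∨ CubeArc f w v :=
  ((SimpleGraph.fromRel_adj _ _ _).1 h).2

theorem hammingDist_le_of_cubeArc {J K U : Type*} [DecidableEq J] [DecidableEq K]
    [Fintype J] [Fintype K] {f : ((J × K → Bool) × U) × J → K × U} (v w : (J × K → Bool) × U)
    (h : CubeArc f v w) : hammingDist v.1 w.1 ≤ 1 := by
  obtain ⟨j, rfl⟩ := h
  exact (hammingDist_flipAt _ _).le

theorem card_arcs_le {J K U : Type*} [DecidableEq J] [DecidableEq K] [DecidableEq U]
    [Fintype J] [Fintype K] (f : ((J × K → Bool) × U) × J → K × U) [DecidableRel (CubeArc f)]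
    (Y : Finset ((J × K → Bool) × U)) :
    ((Y ×ˢ Y).filter fun p => CubeArc f p.1 p.2).card ≤ Fintype.card J * Y.card := by
  refine (card_arcs_le_card_slots f Y).trans ((Finset.card_filter_le _ _).trans_eq ?_)
  rw [Finset.card_product, Finset.card_univ, mul_comm]

theorem card_mul_le_ncard_edgeSet_cubeGraph {J K U : Type*} [DecidableEq J] [DecidableEq K]
    [Fintype J] [Fintype K] [Fintype U] (f : ((J × K → Bool) × U) × J → K × U) :
    Fintype.card J * Fintype.card ((J × K → Bool) × U) ≤ 2 * (cubeGraph f).edgeSet.ncard := by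
  classical
  rw [← coe_edgeFinset, Set.ncard_coe_finset, ← sum_degrees_eq_twice_card_edges, mul_comm,
    ← smul_eq_mul, ← Finset.card_univ]
  refine Finset.card_nsmul_le_sum _ _ _ fun v _ => ?_
  rw [← card_neighborFinset_eq_degree, ← Finset.card_univ]
  refine Finset.card_le_card_of_injOn (fun j => cubeStep v j (f (v, j))) (fun j _ => ?_) ?_
  · rw [Finset.mem_coe, mem_neighborFinset, cubeGraph, fromRel_adj]
    exact ⟨(cubeStep_ne _ _ _).symm, Or.inl ⟨j, rfl⟩⟩
  · intro j _ j' _ h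
    exact (Prod.mk.inj (cubeStep_injective v (a₁ := (j, f (v, j))) (a₂ := (j', f (v, j'))) h)).1

theorem two_rpow_le_two_mul_sq {y : ℝ} (h1 : 1 ≤ y) (h6 : y ≤ 6) : (2 : ℝ) ^ y ≤ 2 * y ^ 2 := by
  have key : ∀ k : ℕ, (k : ℝ) ≤ y → y ≤ k + 1 → (2 : ℝ) ^ y ≤ 2 ^ k * (1 + (y - k)) := by
    intro k hk hk'
    have hb := rpow_one_add_le_one_add_mul_self (s := 1) (by norm_num) (sub_nonneg.2 hk)
      (by linarith : y - k ≤ 1)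
    calc (2 : ℝ) ^ y = 2 ^ ((k : ℝ) + (y - k)) := by ring_nf
      _ = 2 ^ k * (1 + 1) ^ (y - k) := by
        rw [Real.rpow_add (by norm_num), Real.rpow_natCast]; norm_num
      _ ≤ 2 ^ k * (1 + (y - k)) := by
        refine mul_le_mul_of_nonneg_left (by linarith) (by positivity)
  rcases le_total y 2 with h | h
  · have := key 1 (by simpa using h1) (by norm_num; linarith)
    norm_num at this
    nlinarith
  rcases le_total y 3 with h' | h'
  · have := key 2 (by simpa using h) (by norm_num; linarith)
    norm_num at this
    nlinarith
  rcases le_total y 4 with h | h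
  · have := key 3 (by simpa using h') (by norm_num; linarith)
    norm_num at this
    nlinarith
  rcases le_total y 5 with h' | h'
  · have := key 4 (by simpa using h) (by norm_num; linarith)
    norm_num at this
    nlinarith
  · have := key 5 (by simpa using h') (by norm_num; linarith)
    norm_num at this
    nlinarith

theorem half_le_logb_sq_div {x : ℝ} (h2 : 2 ≤ x) (h64 : x ≤ 64) :
    1 / 2 ≤ Real.logb 2 x ^ 2 / x := by
  have hx : 0 < x := by linarith
  have h := two_rpow_le_two_mul_sq (y := Real.logb 2 x)
    ((Real.le_logb_iff_rpow_le (by norm_num) hx).2 (by simpa using h2))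
    ((Real.logb_le_iff_le_rpow (by norm_num) hx).2 (h64.trans (by norm_num)))
  rw [Real.rpow_logb (by norm_num) (by norm_num) hx] at h
  rw [le_div_iff₀ hx]
  linarith

theorem div_le_logb_sq_div {x : ℝ} (h64 : 64 ≤ x) : 36 / x ≤ Real.logb 2 x ^ 2 / x := by
  have hx : 0 < x := by linarith
  have h : 6 ≤ Real.logb 2 x :=
    (Real.le_logb_iff_rpow_le (by norm_num) hx).2 (le_trans (by norm_num) h64)
  gcongr
  nlinarith

theorem sq_div_two_pow_le_logb_sq_div {x : ℝ} {D : ℕ} (h8 : 8 ≤ x) (hD : x ≤ 2 ^ D) :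
    (D : ℝ) ^ 2 / 2 ^ D ≤ Real.logb 2 x ^ 2 / x := by
  have hx : 0 < x := by linarith
  have he : Real.exp 2 ≤ 8 := by
    have := Real.exp_one_lt_d9
    have h0 := Real.exp_pos 1
    rw [show (2 : ℝ) = 1 + 1 by norm_num, Real.exp_add]
    nlinarith
  have hanti := Real.log_div_sqrt_antitoneOn (a := x) (b := 2 ^ D) (he.trans h8)
    ((he.trans h8).trans hD) hD
  have hpos : 0 ≤ Real.log (2 ^ D) / √(2 ^ D) := by
    refine div_nonneg (Real.log_nonneg ?_) (Real.sqrt_nonneg _)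
    linarith
  have hsq := pow_le_pow_left₀ hpos hanti 2
  rw [div_pow, div_pow, Real.sq_sqrt (by positivity), Real.sq_sqrt hx.le, Real.log_pow] at hsq
  have hl : 0 < Real.log 2 := Real.log_pos (by norm_num)
  rw [Real.logb, div_pow]
  calc (D : ℝ) ^ 2 / 2 ^ D = (D * Real.log 2) ^ 2 / 2 ^ D / Real.log 2 ^ 2 := by field_simp
    _ ≤ Real.log x ^ 2 / x / Real.log 2 ^ 2 := by gcongr
    _ = _ := by ring

theorem HasSeparator.mono {V : Type*} [DecidableEq V] {G : SimpleGraph V} {X : Finset V} {b b' : ℝ}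
    (h : HasSeparator G X b) (hb : b ≤ b') : HasSeparator G X b' := by
  obtain ⟨S, A, B, h1, h2, h3, h4, h5, h6, h7, h8⟩ := h
  exact ⟨S, A, B, h1, h2, h3, h4, h5, h6, h7, h8.trans hb⟩

theorem hasSeparator_half {V : Type*} [DecidableEq V] (G : SimpleGraph V) (X : Finset V)
    (hX : 4 ≤ X.card) : HasSeparator G X (1 / 2 * X.card) := by
  obtain ⟨A, hA, hc⟩ := Finset.exists_subset_card_eq (s := X) (n := 2 * X.card / 3) (by omega)
  refine ⟨X \ A, A, ∅, by simpa using hA, Finset.sdiff_disjoint, by simp, by simp, by omega,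
    by simp, by simp, ?_⟩
  have h1 := Finset.card_sdiff_add_card_eq_card hA
  have h2 : 2 * (X \ A).card ≤ X.card := by omega
  have h3 : (2 * (X \ A).card : ℝ) ≤ X.card := by exact_mod_cast h2
  linarith

/-- If small sets of vertices span few arcs and there are no long paths in Hamming balls, then every
set of vertices has a small separator. -/
theorem hasSeparator_of_few_arcs_of_short_paths {V I : Type*} [DecidableEq V] [Fintype I]
    (G : SimpleGraph V) {Arc : V → V → Prop} [DecidableRel Arc]
    (hArc : ∀ v w, G.Adj v w → Arc v w ∨ Arc w v)
    (x : V → I → Bool) (hx : ∀ v w, Arc v w → hammingDist (x v) (x w) ≤ 1)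
    {C r ℓ D : ℕ} (hC : 0 < C) (hr : 0 < r)
    (hD : 16 ≤ D) (hφ : (10 * C / r : ℝ) ≤ D ^ 2 / 2 ^ D) (hφ' : (10 * C / r : ℝ) ≤ 1 / 2)
    (hcard : ∀ Y : Finset V, ((Y ×ˢ Y).filter fun p => Arc p.1 p.2).card ≤ C * Y.card)
    (hpath : ∀ (a : I → Bool) (l : List V), l.Nodup → l.IsChain G.Adj →
      (∀ v ∈ l, hammingDist (x v) a ≤ 2 * r) → l.length ≤ ℓ)
    (hsmall : ∀ Y : Finset V, Y.Nonempty → Y.card ≤ 2 ^ (2 * D + 3) →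
        D * ((Y ×ˢ Y).filter fun p => Arc p.1 p.2).card ≤ (D + 1) * Y.card)
    (hℓr : ℓ * r ≤ C * 2 ^ (2 * D + 2)) (hℓ : 10 * ℓ ≤ 2 ^ (2 * D + 2))
    (X : Finset V) (hX : 4 ≤ X.card) (hX' : X.card ≤ 2 ^ 2 ^ D) :
    HasSeparator G X ((X.card : ℝ) / Real.logb 2 X.card *
      (Real.logb 2 (Real.logb 2 X.card)) ^ 2) := by
  set L := Real.logb 2 X.card with hL
  suffices h : ∃ φ : ℝ, HasSeparator G X (φ * X.card) ∧ φ ≤ Real.logb 2 L ^ 2 / L by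
    obtain ⟨φ, h, hφ⟩ := h
    refine h.mono ((mul_le_mul_of_nonneg_right hφ (Nat.cast_nonneg _)).trans_eq (by ring))
  have hX0 : (0 : ℝ) < X.card := by exact_mod_cast (by omega : 0 < X.card)
  have hle : ∀ k : ℕ, X.card ≤ 2 ^ k → L ≤ k := fun k hk => by
    rw [hL, Real.logb_le_iff_le_rpow (by norm_num) hX0, Real.rpow_natCast]
    exact_mod_cast hk
  have hge : ∀ k : ℕ, 2 ^ k ≤ X.card → k ≤ L := fun k hk => by
    rw [hL, Real.le_logb_iff_rpow_le (by norm_num) hX0, Real.rpow_natCast]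
    exact_mod_cast hk
  have hL2 : 2 ≤ L := by exact_mod_cast hge 2 (by omega)
  by_cases h64 : X.card ≤ 2 ^ 64
  · exact ⟨1 / 2, hasSeparator_half G X hX,
      half_le_logb_sq_div hL2 (by exact_mod_cast hle 64 h64)⟩
  push Not at h64
  have hL64 : 64 ≤ L := by exact_mod_cast hge 64 h64.le
  have hDR : (16 : ℝ) ≤ D := by exact_mod_cast hD
  by_cases hM : X.card ≤ 2 ^ (2 * D + 3)
  · have h64R : (2 ^ 64 : ℝ) ≤ X.card := by exact_mod_cast h64.le
    have h4D : (4 / D : ℝ) ≤ 1 / 4 := by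
      rw [div_le_iff₀ (by linarith)]; linarith
    have h16 : (16 / X.card : ℝ) ≤ 1 / 4 := by
      rw [div_le_iff₀ hX0]; linarith
    refine ⟨4 / D + 16 / X.card, hasSeparator_of_sparse_cuts G X _ (by positivity) (by linarith)
      fun Y hY hYX => ?_, le_trans ?_ (div_le_logb_sq_div hL64)⟩
    · obtain ⟨A, S, h1, h2, h3⟩ := exists_isCutOff_of_few_arcs G Arc hArc Y hD (by omega)
        (hsmall Y (Finset.card_pos.1 (by omega)) ((Finset.card_le_card hY).trans hM))
      refine ⟨A, S, h1, h2, h3.trans ?_⟩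
      have hYR : (X.card : ℝ) ≤ 2 * Y.card := by exact_mod_cast hYX
      have : (8 / Y.card : ℝ) ≤ 16 / X.card := by
        rw [div_le_div_iff₀ (by linarith) hX0]; linarith
      gcongr
    · have h3 : L ≤ 3 * D := by
        have := hle _ hM
        push_cast at this
        linarith
      have h4 : L ≤ X.card := hle _ Nat.lt_two_pow_self.le
      have h5 : (4 / D : ℝ) ≤ 12 / L := by
        rw [div_le_div_iff₀ (by linarith) (by linarith)]; linarith
      have h6 : (16 / X.card : ℝ) ≤ 16 / L := by gcongr
      calc _ ≤ 12 / L + 16 / L := add_le_add h5 h6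
        _ = 28 / L := by ring
        _ ≤ 36 / L := by gcongr; norm_num
  · push Not at hM
    have hL2D := hle _ hX'
    push_cast at hL2D
    refine ⟨10 * C / r, hasSeparator_of_sparse_cuts G X _ (by positivity) hφ' fun Y hY hYX => ?_,
      hφ.trans (sq_div_two_pow_le_logb_sq_div (by linarith) hL2D)⟩
    have hYc : 2 ^ (2 * D + 2) ≤ Y.card := by
      rw [pow_succ] at hM
      omega
    have hY0 : 0 < Y.card := lt_of_lt_of_le (by positivity) hYc
    obtain ⟨A, S, h1, h2, h3⟩ := exists_isCutOff_of_cube G hArc x hx Y (Finset.card_pos.1 hY0) hC hr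
      (hcard Y) hpath (hℓr.trans (Nat.mul_le_mul_left _ hYc)) (hℓ.trans hYc)
    refine ⟨A, S, h1, h2, ?_⟩
    have h4 : (S.card * r : ℝ) ≤ 10 * C * A.card := by exact_mod_cast h3
    rw [div_mul_eq_mul_div, le_div_iff₀ (by exact_mod_cast hr)]
    exact h4

/-- Every set of at least four vertices of `G` has a small separator. -/
def HasSmallSeparators {V : Type*} [DecidableEq V] (G : SimpleGraph V) : Prop :=
  ∀ X : Finset V, 4 ≤ X.card → HasSeparator G X ((X.card : ℝ) / Real.logb 2 X.card *
    (Real.logb 2 (Real.logb 2 X.card)) ^ 2)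

theorem add_mul_le_mul_of_mul_lt {W s μ d D C m e : ℕ} (hD : 0 < D) (hW : W + (s + μ) = d)
    (hd : (s + μ) * (D + 1) + D * (C + μ + 2) ≤ d) (hm : 1 ≤ m)
    (he : (D + 1) * m < D * e) : μ + 2 + (d + C) * m ≤ W * e := by
  refine Nat.le_of_mul_le_mul_left (le_trans ?_ ((Nat.mul_le_mul_left W he).trans_eq
    (Nat.mul_left_comm _ _ _))) hD
  obtain ⟨k, rfl⟩ := Nat.exists_eq_add_of_le' hm
  subst hW
  have h := Nat.mul_le_mul_left (k + 1) hd
  have h' := Nat.zero_le (k * (D * (μ + 2)))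
  nlinarith

theorem path_count_le {c C P d s : ℕ} (hC : C = 2 ^ c) (hs : s = 2048 * C ^ 3 * P)
    (h4s : 4 * s ≤ d) (hd : 2 ≤ d) :
    3 * (2 ^ s * 2 ^ d * (8 * C) ^ (2 * (16 * C * P)) * (4 * C) ^ (4 * d)) ≤
      (8 * C) ^ (4 * d) := by
  have hC0 : 1 ≤ C := hC ▸ Nat.one_le_two_pow
  have h2 : 8 * C = 2 ^ (c + 3) := by rw [hC]; ring
  have h3 : (c + 3) * (2 * (16 * C * P)) ≤ s := by
    have h4 : c + 3 ≤ 8 * C := h2 ▸ Nat.lt_two_pow_self.le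
    calc _ ≤ 8 * C * (2 * (16 * C * P)) := Nat.mul_le_mul_right _ h4
      _ = 256 * C ^ 2 * P := by ring
      _ ≤ 2048 * C ^ 3 * P := by gcongr <;> omega
      _ = s := hs.symm
  have h5 : (8 * C) ^ (2 * (16 * C * P)) = 2 ^ ((c + 3) * (2 * (16 * C * P))) := by
    rw [h2, ← pow_mul]
  have h6 : (8 * C) ^ (4 * d) = 2 ^ (4 * d) * (4 * C) ^ (4 * d) := by
    rw [← mul_pow, ← mul_assoc 2 4 C, show 2 * 4 = 8 from rfl]
  rw [h5, h6, ← mul_assoc]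
  refine Nat.mul_le_mul_right _ ?_
  calc 3 * (2 ^ s * 2 ^ d * 2 ^ ((c + 3) * (2 * (16 * C * P)))) ≤
      2 ^ 2 * (2 ^ s * 2 ^ d * 2 ^ ((c + 3) * (2 * (16 * C * P)))) :=
        Nat.mul_le_mul_right _ (by norm_num)
    _ = 2 ^ (2 + (s + d + (c + 3) * (2 * (16 * C * P)))) := by simp only [pow_add]
    _ ≤ 2 ^ (4 * d) := Nat.pow_le_pow_right (by norm_num) (by omega)

theorem dense_count_le {W s μ d D C m k : ℕ} (hD : 0 < D) (hW : W + (s + μ) = d)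
    (hd : (s + μ) * (D + 1) + D * (C + μ + 2) ≤ d) (hm : 1 ≤ m) (hm' : m ≤ 2 ^ μ) (hk : 0 < k) :
    3 * 2 ^ μ * ((2 ^ d) ^ m * 2 ^ (m * C) * m ^ (m + m / D + 1)) ≤
      (k * 2 ^ (W + μ)) ^ (m + m / D + 1) := by
  have he : (D + 1) * m < D * (m + m / D + 1) := by
    have hmd := Nat.div_add_mod m D
    have hmod := Nat.mod_lt m hD
    rw [mul_add, mul_add, add_mul]
    omega
  generalize m + m / D + 1 = e at he
  have h := add_mul_le_mul_of_mul_lt hD hW hd hm he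
  calc 3 * 2 ^ μ * ((2 ^ d) ^ m * 2 ^ (m * C) * m ^ e) ≤
      2 ^ 2 * 2 ^ μ * ((2 ^ d) ^ m * 2 ^ (m * C) * (2 ^ μ) ^ e) := by gcongr; norm_num
    _ = 2 ^ (μ + 2 + (d + C) * m + μ * e) := by
      simp only [← pow_mul, ← pow_add]; congr 1; ring
    _ ≤ 2 ^ ((W + μ) * e) := Nat.pow_le_pow_right (by norm_num) (by rw [add_mul W]; omega)
    _ = (2 ^ (W + μ)) ^ e := pow_mul _ _ _
    _ ≤ _ := Nat.pow_le_pow_left (Nat.le_mul_of_pos_left _ hk) _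

/-- Parameters for which the random construction below has average degree at least `2 ^ c`. -/
theorem exists_parameters (c : ℕ) : ∃ C D P d s W : ℕ, C = 2 ^ c ∧ 1 ≤ C ∧ 2 ^ 20 * C ≤ D ∧
    16 ≤ P ∧ d = 2 ^ D ∧ d = P * D ^ 2 ∧ s = 2048 * C ^ 3 * P ∧ 4 * s ≤ d ∧
    W + (s + (2 * D + 3)) = d ∧
    (s + (2 * D + 3)) * (D + 1) + D * (C + (2 * D + 3) + 2) ≤ d := by
  obtain ⟨C, hC⟩ : ∃ C, C = 2 ^ c := ⟨_, rfl⟩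
  have hC0 : 1 ≤ C := hC ▸ Nat.one_le_two_pow
  obtain ⟨D, hD⟩ : ∃ D, D = 2 ^ (3 * c + 20) := ⟨_, rfl⟩
  have hDC : D = 2 ^ 20 * C ^ 3 := by rw [hD, hC]; ring
  have hC3 : C ≤ C ^ 3 := Nat.le_self_pow (by norm_num) C
  obtain ⟨T, hT⟩ : ∃ T, D = T + 4 + 2 * (3 * c + 20) := by
    have h : ∀ k, 4 + 2 * (k + 20) ≤ 2 ^ (k + 20) := fun k => by
      have := Nat.lt_two_pow_self (n := k)
      rw [pow_add]; omega
    obtain ⟨T, hT⟩ := Nat.exists_eq_add_of_le (h (3 * c))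
    exact ⟨T, by omega⟩
  obtain ⟨P, hP⟩ : ∃ P, P = 2 ^ (T + 4) := ⟨_, rfl⟩
  have hP16 : 16 ≤ P := by
    have := Nat.one_le_two_pow (n := T)
    rw [hP, pow_add]; omega
  obtain ⟨d, hd⟩ : ∃ d, d = 2 ^ D := ⟨_, rfl⟩
  have hdP : d = P * D ^ 2 := by
    calc d = 2 ^ (T + 4 + 2 * (3 * c + 20)) := by rw [hd, ← hT]
      _ = 2 ^ (T + 4) * (2 ^ (3 * c + 20)) ^ 2 := by rw [pow_add, mul_comm 2, pow_mul]
      _ = P * D ^ 2 := by rw [hP, hD]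
  have hCD : 2 ^ 20 * C ≤ D := by rw [hDC]; omega
  obtain ⟨s, hs⟩ : ∃ s, s = 2048 * C ^ 3 * P := ⟨_, rfl⟩
  have hsD : 512 * s = P * D := by rw [hs, hDC]; ring
  have hPD : 16 * D ^ 2 ≤ P * D ^ 2 := Nat.mul_le_mul_right _ hP16
  have hmain : (s + (2 * D + 3)) * (D + 1) + D * (C + (2 * D + 3) + 2) ≤ d := by
    have h1 : 512 * (s * D) = P * D ^ 2 := by rw [← mul_assoc, hsD]; ring
    have h2 : s ≤ s * D := Nat.le_mul_of_pos_right _ (by omega)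
    have h3 : D * C ≤ D * D := Nat.mul_le_mul_left _ (by omega)
    have h4 : 10 * D ≤ D * D := Nat.mul_le_mul_right _ (by omega)
    rw [hdP]
    nlinarith
  have h4s : 4 * s ≤ d := by
    have h1 : 512 * (s * D) = P * D ^ 2 := by rw [← mul_assoc, hsD]; ring
    have h2 : s ≤ s * D := Nat.le_mul_of_pos_right _ (by omega)
    omega
  have hle : s + (2 * D + 3) ≤ d :=
    ((Nat.le_mul_of_pos_right _ (Nat.succ_pos D)).trans (Nat.le_add_right _ _)).trans hmain
  exact ⟨C, D, P, d, s, d - (s + (2 * D + 3)), hC, hC0, hCD, hP16, hd, hdP, hs, h4s,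
    Nat.sub_add_cancel hle, hmain⟩

/-- There are graphs of arbitrarily large average degree with small separators. -/
theorem exists_graph_hasSeparator (c : ℕ) :
    ∃ (V : Type) (_ : Fintype V) (_ : DecidableEq V) (G : SimpleGraph V), Nonempty V ∧
      2 ^ c * Fintype.card V ≤ 2 * G.edgeSet.ncard ∧
      HasSmallSeparators G := by
  classical
  obtain ⟨C, D, P, d, s, W, hC, hC0, hCD, hP, hd, hdP, hs, h4s, hW, hmain⟩ := exists_parameters c
  have hPD : P * 2 ≤ P * D ^ 2 := Nat.mul_le_mul_left _ (by nlinarith)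
  have hPD' : P * 16 ≤ P * D ^ 2 := Nat.mul_le_mul_left _ (by nlinarith)
  obtain ⟨s', hs'⟩ : ∃ s', s' = 2048 * C ^ 2 * P := ⟨_, rfl⟩
  have hss : C * s' = s := by rw [hs, hs']; ring
  have hs0 : 0 < s' := by
    have h1 : 0 < C ^ 2 := Nat.pow_pos hC0
    have h2 : 0 < P := by omega
    rw [hs']
    positivity
  obtain ⟨u, hu⟩ : ∃ u, u = 2 ^ (W + (2 * D + 3)) := ⟨_, rfl⟩
  have hu0 : 0 < u := hu ▸ Nat.two_pow_pos _
  have hcardV : Fintype.card ((Fin C × Fin s' → Bool) × Fin u) = 2 ^ d := by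
    simp only [Fintype.card_prod, Fintype.card_fun, Fintype.card_bool, Fintype.card_fin]
    rw [hss, hu, ← pow_add, ← hW, Nat.add_left_comm]
  have : Nonempty (Fin s') := ⟨⟨0, hs0⟩⟩
  have : Nonempty (Fin u) := ⟨⟨0, hu0⟩⟩
  obtain ⟨f, hpath, hsmall⟩ := exists_cubeGraph (J := Fin C) (K := Fin s') (U := Fin u)
    hcardV rfl (R := 2 * (16 * C * P)) (κ := 8 * C) (ℓ := 4 * d) (D := D) (M := 2 ^ (2 * D + 3))
    (Nat.two_pow_pos _) (by omega)
    (by simp only [Fintype.card_prod, Fintype.card_fin]; rw [hs']; apply le_of_eq; ring)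
    (by
      simp only [Fintype.card_prod, Fintype.card_fin, Fintype.card_fun, Fintype.card_bool]
      rw [hss]
      exact path_count_le hC hs h4s (by omega))
    (by
      intro m hm hm'
      simp only [Fintype.card_prod, Fintype.card_fin]
      rw [hu]
      exact dense_count_le (by omega) hW hmain hm hm' hs0)
  refine ⟨_, inferInstance, inferInstance, cubeGraph f, ⟨⟨fun _ => false, ⟨0, hu0⟩⟩⟩,
    ?_, fun X hX => ?_⟩
  · have := card_mul_le_ncard_edgeSet_cubeGraph f
    rw [← hC]
    rwa [Fintype.card_fin] at this
  · have hC0R : (0 : ℝ) < C := by exact_mod_cast hC0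
    have hPR : (16 : ℝ) ≤ P := by exact_mod_cast hP
    have hr : (10 * C / (16 * C * P : ℕ) : ℝ) = 10 / (16 * P) := by
      push_cast
      field_simp
    have hφ : (10 * C / (16 * C * P : ℕ) : ℝ) ≤ D ^ 2 / 2 ^ D := by
      have hdR : (2 ^ D : ℝ) = P * D ^ 2 := by exact_mod_cast hd.symm.trans hdP
      have hDR : (0 : ℝ) < D := by exact_mod_cast (by omega : 0 < D)
      rw [hr, hdR, div_le_div_iff₀ (by positivity) (by positivity)]
      have : (0 : ℝ) ≤ D ^ 2 * P := by positivity
      linarith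
    have hd2 : 2 ^ (2 * D + 2) = 4 * d ^ 2 := by rw [hd]; ring
    refine hasSeparator_of_few_arcs_of_short_paths (Arc := CubeArc f) (C := C) (r := 16 * C * P)
      (ℓ := 4 * d) (D := D) (cubeGraph f) cubeArc_of_adj (fun v => v.1) hammingDist_le_of_cubeArc
      hC0 (Nat.mul_pos (by omega) (by omega)) (by omega) hφ ?_ (fun Y => ?_) (fun a l => hpath a l)
      (fun Y => ?_) ?_ ?_ X hX ?_
    · rw [hr, div_le_iff₀ (by positivity)]
      linarith
    · simpa using card_arcs_le f Y
    · convert hsmall Y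
    · rw [hd2]
      have := Nat.mul_le_mul_left (4 * C * d) (show P * 16 ≤ d by omega)
      linarith
    · rw [hd2]
      have := Nat.mul_le_mul_left d (show 10 ≤ d by omega)
      linarith
    · rw [← hd, ← hcardV]
      exact Finset.card_le_univ X

theorem HasSeparator.of_map {V W : Type*} [DecidableEq V] [DecidableEq W] {G : SimpleGraph V}
    {H : SimpleGraph W} (φ : H ↪g G) {X : Finset W} {b : ℝ}
    (h : HasSeparator G (X.map φ.toEmbedding) b) : HasSeparator H X b := by
  obtain ⟨S, A, B, hX, hSA, hSB, hAB, hA, hB, hadj, hS⟩ := h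
  have hpre : ∀ {Z : Finset V}, Z ⊆ X.map φ.toEmbedding →
      ((X.filter fun x => φ x ∈ Z).map φ.toEmbedding) = Z := fun {Z} hZ => by
    ext z
    simp only [Finset.mem_map, Finset.mem_filter]
    constructor
    · rintro ⟨x, hx, rfl⟩
      exact hx.2
    · intro hz
      obtain ⟨x, hx, rfl⟩ := Finset.mem_map.1 (hZ hz)
      exact ⟨x, ⟨hx, hz⟩, rfl⟩
  have hcard : ∀ {Z : Finset V}, Z ⊆ X.map φ.toEmbedding →
      (X.filter fun x => φ x ∈ Z).card = Z.card := fun {Z} hZ => by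
    rw [← Finset.card_map φ.toEmbedding, hpre hZ]
  have hdisj : ∀ {Z Z' : Finset V}, Disjoint Z Z' →
      Disjoint (X.filter fun x => φ x ∈ Z) (X.filter fun x => φ x ∈ Z') := fun h =>
    Finset.disjoint_filter.2 fun _ _ hz hz' => Finset.disjoint_left.1 h hz hz'
  have hsS : S ⊆ X.map φ.toEmbedding := hX ▸ fun z hz => by simp [hz]
  have hsA : A ⊆ X.map φ.toEmbedding := hX ▸ fun z hz => by simp [hz]
  have hsB : B ⊆ X.map φ.toEmbedding := hX ▸ fun z hz => by simp [hz]
  rw [Finset.card_map] at hA hB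
  refine ⟨X.filter fun x => φ x ∈ S, X.filter fun x => φ x ∈ A, X.filter fun x => φ x ∈ B, ?_,
    hdisj hSA, hdisj hSB, hdisj hAB, by rwa [hcard hsA], by rwa [hcard hsB], ?_, by rwa [hcard hsS]⟩
  · ext x
    have hx : x ∈ X → φ x ∈ S ∪ A ∪ B := fun hx => hX ▸ Finset.mem_map_of_mem φ.toEmbedding hx
    simp only [Finset.mem_union, Finset.mem_filter] at hx ⊢
    tauto
  · intro a ha b hb hab
    exact hadj _ (Finset.mem_filter.1 ha).2 _ (Finset.mem_filter.1 hb).2 (φ.map_rel_iff.2 hab)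

theorem HasSeparator.sepV_le {V : Type*} [Fintype V] [DecidableEq V] {G : SimpleGraph V} {b : ℝ}
    (h : HasSeparator G Finset.univ b) : (sepV G : ℝ) ≤ b := by
  obtain ⟨S, A, B, hX, hSA, hSB, hAB, hA, hB, hadj, hS⟩ := h
  rw [Finset.card_univ, ← Nat.card_eq_fintype_card] at hA hB
  refine le_trans (Nat.cast_le.2 (Nat.sInf_le ?_)) hS
  exact ⟨S, A, B, by rw [← Finset.coe_univ, ← hX]; push_cast; rfl, by exact_mod_cast hSA,
    by exact_mod_cast hSB, by exact_mod_cast hAB, by rwa [Set.ncard_coe_finset],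
    by rwa [Set.ncard_coe_finset], fun a ha b hb => hadj a ha b hb, (Set.ncard_coe_finset S).symm⟩

theorem HasSmallSeparators.of_embedding {V W : Type*} [DecidableEq V] [DecidableEq W]
    {G : SimpleGraph V} {H : SimpleGraph W} (hG : HasSmallSeparators G) (φ : H ↪g G) :
    HasSmallSeparators H := fun X hX => by
  have h := hG (X.map φ.toEmbedding) (by rwa [Finset.card_map])
  rw [Finset.card_map] at h
  exact h.of_map φ

/-- Corollary 2.2: there is a hereditary class `F` of graphs (closed under isomorphism and
under taking induced subgraphs) such that every `n`-vertex graph in `F` (with `n ≥ 4`) has a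
vertex separator of size at most `(n/log n)·(log log n)²`, yet for every `C > 0` some
`n`-vertex graph in `F` has more than `Cn` edges. -/
theorem stmt2 :
    ∃ F : ∀ n : ℕ, SimpleGraph (Fin n) → Prop,
      -- closed under isomorphism and under taking induced subgraphs
      (∀ (n : ℕ) (G : SimpleGraph (Fin n)), F n G →
        ∀ (s : Set (Fin n)) (m : ℕ) (G' : SimpleGraph (Fin m)),
          Nonempty ((G.induce s) ≃g G') → F m G') ∧
      -- (a) small vertex separators
      (∀ (n : ℕ) (G : SimpleGraph (Fin n)), F n G → 4 ≤ n →
        (sepV G : ℝ) ≤ ((n : ℝ) / Real.logb 2 n) * (Real.logb 2 (Real.logb 2 n)) ^ 2) ∧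
      -- (b) superlinearly many edges
      (∀ C : ℝ, 0 < C → ∃ (n : ℕ) (G : SimpleGraph (Fin n)),
        F n G ∧ C * n < (G.edgeSet.ncard : ℝ)) := by
  refine ⟨fun n G => HasSmallSeparators G, fun n G hG s m G' ⟨e⟩ => ?_, fun n G hG hn => ?_,
    fun C _ => ?_⟩
  · exact hG.of_embedding ((Embedding.induce s).comp e.symm.toEmbedding)
  · have h := hG Finset.univ (by simpa using hn)
    rw [Finset.card_univ, Fintype.card_fin] at h
    exact h.sepV_le
  · obtain ⟨c, hc⟩ := pow_unbounded_of_one_lt (2 * C) (one_lt_two (α := ℝ))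
    obtain ⟨V, _, _, G, hV, hE, hG⟩ := exists_graph_hasSeparator c
    have e := Iso.map (Fintype.equivFin V) G
    refine ⟨Fintype.card V, _, HasSmallSeparators.of_embedding hG e.symm.toEmbedding, ?_⟩
    have hcard := Nat.card_congr e.mapEdgeSet
    rw [Nat.card_coe_set_eq, Nat.card_coe_set_eq] at hcard
    rw [← hcard]
    have hER : (2 ^ c * Fintype.card V : ℝ) ≤ 2 * G.edgeSet.ncard := by exact_mod_cast hE
    have hV0 : (0 : ℝ) < Fintype.card V := by exact_mod_cast Fintype.card_pos
    nlinarith [mul_lt_mul_of_pos_right hc hV0]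
end

section
/- Let G be a graph on an n-element vertex set V, let d be an integer with d ≥ Δ(G), and let A* = A(G) + diag(d − deg_G(v)) (the adjacency matrix of the d-regular multigraph obtained from G by adding self-loops). Let λ₁ ≥ λ₂ ≥ … ≥ λ_n be the eigenvalues of the real symmetric matrix A*, with multiplicity. Then for every 1 ≤ k ≤ n and every collection S₁, …, S_k of pairwise disjoint nonempty subsets of V, one has (d − λ_k)/2 ≤ max_{1 ≤ i ≤ k} φ_G(Sᵢ). -/
open SimpleGraph

attribute [local instance] Classical.propDecidable

/-- `phi G A = |∂_G(A)| / |A|`, the edge expansion of `A` in `G`. -/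
noncomputable def phi {V : Type*} (G : SimpleGraph V) (A : Set V) : ℝ :=
  (cutEdges G A).ncard / A.ncard

/-- If `x` is orthogonal to all eigenvectors of the Hermitian matrix `M` with eigenvalue larger
than `t`, then the Rayleigh quotient of `x` is at most `t`. -/
lemma Matrix.IsHermitian.dotProduct_mulVec_le {V : Type*} [Fintype V] [DecidableEq V]
    {M : Matrix V V ℝ} (hM : M.IsHermitian) (t : ℝ) (x : V → ℝ)
    (h : ∀ j, t < hM.eigenvalues j → ⇑(hM.eigenvectorBasis j) ⬝ᵥ x = 0) :
    x ⬝ᵥ M.mulVec x ≤ t * (x ⬝ᵥ x) := by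
  have expand : ∀ y z : V → ℝ, y ⬝ᵥ z = ∑ j, (⇑(hM.eigenvectorBasis j) ⬝ᵥ y) *
      (⇑(hM.eigenvectorBasis j) ⬝ᵥ z) := by
    intro y z
    have := hM.eigenvectorBasis.sum_inner_mul_inner (WithLp.toLp 2 y) (WithLp.toLp 2 z)
    simp only [EuclideanSpace.inner_eq_star_dotProduct, star_trivial] at this
    rw [dotProduct_comm y z, ← this]
    refine Finset.sum_congr rfl fun j _ => ?_
    rw [dotProduct_comm z]
  have hT : M.transpose = M := by simpa [Matrix.IsHermitian, Matrix.conjTranspose] using! hM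
  rw [expand x x, expand x (M.mulVec x), Finset.mul_sum]
  refine Finset.sum_le_sum fun j _ => ?_
  have hj : ⇑(hM.eigenvectorBasis j) ⬝ᵥ M.mulVec x
      = hM.eigenvalues j * (⇑(hM.eigenvectorBasis j) ⬝ᵥ x) := by
    rw [Matrix.dotProduct_mulVec, ← Matrix.mulVec_transpose, hT, hM.mulVec_eigenvectorBasis,
      smul_dotProduct, smul_eq_mul]
  rw [hj]
  rcases lt_or_ge t (hM.eigenvalues j) with hlt | hge
  · simp [h j hlt]
  · nlinarith [mul_self_nonneg (⇑(hM.eigenvectorBasis j) ⬝ᵥ x)]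

/-- The Dirichlet form of an indicator function is at most the size of the edge boundary. -/
lemma sum_adj_indicator_sub_sq_le {V : Type*} [Fintype V] (G : SimpleGraph V) (A : Set V) :
    (∑ u, ∑ v, if G.Adj u v then (A.indicator (1 : V → ℝ) u - A.indicator 1 v) ^ 2 else 0) / 2
      ≤ ((cutEdges G A).ncard : ℝ) := by
  let f : V → V → ℝ := fun u v => if G.Adj u v ∧ u ∈ A ∧ v ∉ A then 1 else 0
  have hsplit : ∀ u v, (if G.Adj u v then
      (A.indicator (1 : V → ℝ) u - A.indicator 1 v) ^ 2 else 0) = f u v + f v u := by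
    intro u v
    by_cases h : G.Adj u v <;> by_cases hu : u ∈ A <;> by_cases hv : v ∈ A <;>
      simp [f, h, hu, hv, G.adj_comm v u]
  simp only [hsplit, Finset.sum_add_distrib]
  rw [Finset.sum_comm (f := fun u v => f v u), add_self_div_two]
  have hcard : ∑ u, ∑ v, f u v
      = ({p : V × V | G.Adj p.1 p.2 ∧ p.1 ∈ A ∧ p.2 ∉ A} : Set (V × V)).ncard := by
    rw [← Fintype.sum_prod_type', Finset.sum_boole, Set.ncard_eq_toFinset_card']
    simp
  rw [hcard, Nat.cast_le]
  refine Set.ncard_le_ncard_of_injOn (fun p => s(p.1, p.2)) ?_ ?_ (Set.toFinite _)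
  · rintro ⟨u, v⟩ ⟨h, hu, hv⟩
    exact ⟨h, u, hu, v, hv, rfl⟩
  · rintro ⟨u, v⟩ ⟨-, hu, hv⟩ ⟨u', v'⟩ ⟨-, hu', hv'⟩ heq
    simp only [Sym2.eq_iff] at heq
    rcases heq with ⟨rfl, rfl⟩ | ⟨rfl, rfl⟩
    · rfl
    · exact (hv' hu).elim

/-- A linear combination of indicators of disjoint sets, evaluated at a point of one of them. -/
lemma sum_mul_indicator_of_mem {V ι : Type*} [Fintype ι] {S : ι → Set V}
    (hdisj : ∀ i j, i ≠ j → Disjoint (S i) (S j)) (g : ι → ℝ) {i : ι} {u : V} (hu : u ∈ S i) :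
    ∑ j, g j * (S j).indicator 1 u = g i := by
  rw [Finset.sum_eq_single i]
  · simp [hu]
  · intro j _ hj
    simp [Set.disjoint_right.mp (hdisj j i hj) hu]
  · simp

lemma sum_mul_indicator_of_notMem {V ι : Type*} [Fintype ι] {S : ι → Set V}
    (g : ι → ℝ) {u : V} (hu : ∀ i, u ∉ S i) :
    ∑ j, g j * (S j).indicator 1 u = 0 := by
  simp [hu]

lemma sq_sum_mul_indicator {V ι : Type*} [Fintype ι] {S : ι → Set V}
    (hdisj : ∀ i j, i ≠ j → Disjoint (S i) (S j)) (c : ι → ℝ) (u : V) :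
    (∑ i, c i * (S i).indicator 1 u) ^ 2 = ∑ i, c i ^ 2 * (S i).indicator 1 u := by
  by_cases hu : ∃ i, u ∈ S i
  · obtain ⟨i, hi⟩ := hu
    rw [sum_mul_indicator_of_mem hdisj c hi, sum_mul_indicator_of_mem hdisj (fun i => c i ^ 2) hi]
  · push Not at hu
    rw [sum_mul_indicator_of_notMem c hu, sum_mul_indicator_of_notMem (fun i => c i ^ 2) hu]
    simp

lemma sq_sub_sum_mul_indicator_le {V ι : Type*} [Fintype ι] {S : ι → Set V}
    (hdisj : ∀ i j, i ≠ j → Disjoint (S i) (S j)) (c : ι → ℝ) (u v : V) :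
    (∑ i, c i * (S i).indicator 1 u - ∑ i, c i * (S i).indicator 1 v) ^ 2
      ≤ 2 * ∑ i, c i ^ 2 * ((S i).indicator (1 : V → ℝ) u - (S i).indicator 1 v) ^ 2 := by
  by_cases h : ∃ i, u ∈ S i ∧ v ∈ S i
  · obtain ⟨i, hu, hv⟩ := h
    rw [sum_mul_indicator_of_mem hdisj c hu, sum_mul_indicator_of_mem hdisj c hv, sub_self]
    simp only [ne_eq, OfNat.ofNat_ne_zero, not_false_eq_true, zero_pow]
    positivity
  · push Not at h
    have hterm : ∀ i, c i ^ 2 * ((S i).indicator (1 : V → ℝ) u - (S i).indicator 1 v) ^ 2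
        = c i ^ 2 * (S i).indicator 1 u + c i ^ 2 * (S i).indicator 1 v := by
      intro i
      by_cases hu : u ∈ S i
      · simp [hu, h i hu]
      · by_cases hv : v ∈ S i <;> simp [hu, hv]
    simp only [hterm, Finset.sum_add_distrib]
    rw [← sq_sum_mul_indicator hdisj, ← sq_sum_mul_indicator hdisj]
    nlinarith [sq_nonneg (∑ i, c i * (S i).indicator 1 u + ∑ i, c i * (S i).indicator 1 v)]

/-- The quadratic form of the regularized adjacency matrix in terms of the Dirichlet form. -/
lemma dotProduct_regularized_mulVec {V : Type*} [Fintype V] [DecidableEq V] (G : SimpleGraph V)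
    (d : ℝ) (x : V → ℝ) :
    x ⬝ᵥ (Matrix.of fun u v : V => (if G.Adj u v then (1 : ℝ) else 0) +
        (if u = v then d - (G.degree u : ℝ) else 0)).mulVec x
      = d * (x ⬝ᵥ x) - (∑ u, ∑ v, if G.Adj u v then (x u - x v) ^ 2 else 0) / 2 := by
  rw [← G.lapMatrix_toLinearMap₂' ℝ x, Matrix.toLinearMap₂'_apply']
  have hM : (Matrix.of fun u v : V => (if G.Adj u v then (1 : ℝ) else 0) +
        (if u = v then d - (G.degree u : ℝ) else 0)) = d • 1 - G.lapMatrix ℝ := by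
    ext u v
    by_cases h : u = v
    · subst h
      simp [lapMatrix, degMatrix]
    · simp [lapMatrix, degMatrix, h]
  rw [hM, Matrix.sub_mulVec, dotProduct_sub, Matrix.smul_mulVec, Matrix.one_mulVec,
    dotProduct_smul, smul_eq_mul]

/-- Lemma 2.10 (easy direction of higher-order Cheeger): let `G` be a graph on `n` vertices,
`d ≥ Δ(G)`, let `λ₁ ≥ ⋯ ≥ λ_n` be the eigenvalues of `A(G) + diag(d − deg v)` (the `d`-regular
multigraph regularization of `G`). Then for every `1 ≤ k ≤ n` and pairwise disjoint nonempty
sets `S₁, …, S_k`, one has `(d − λ_k)/2 ≤ max_i φ_G(Sᵢ)`. -/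
theorem stmt6 {V : Type} [Fintype V] [DecidableEq V] (G : SimpleGraph V)
    (d : ℕ) (hd : ∀ v : V, G.degree v ≤ d)
    (hM : (Matrix.of fun u v : V =>
        (if G.Adj u v then (1 : ℝ) else 0) +
          (if u = v then (d : ℝ) - (G.degree u : ℝ) else 0)).IsHermitian)
    (lam : Fin (Fintype.card V) → ℝ) (e : Fin (Fintype.card V) ≃ V)
    (hlam : lam = hM.eigenvalues ∘ e) (hanti : Antitone lam)
    (k : ℕ) (hk1 : 1 ≤ k) (hkn : k ≤ Fintype.card V)
    (S : Fin k → Set V) (hne : ∀ i, (S i).Nonempty)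
    (hdisj : ∀ i j, i ≠ j → Disjoint (S i) (S j)) :
    ∃ i : Fin k, ((d : ℝ) - lam ⟨k - 1, by omega⟩) / 2 ≤ phi G (S i) := by
  by_contra! hcon
  set t := lam ⟨k - 1, by omega⟩ with ht
  let B : Matrix (Fin (k - 1)) (Fin k) ℝ := Matrix.of fun p i =>
    ⇑(hM.eigenvectorBasis (e ⟨p, by omega⟩)) ⬝ᵥ (S i).indicator 1
  obtain ⟨c, hc, hc0⟩ := (Submodule.ne_bot_iff _).mp
    (LinearMap.ker_ne_bot_of_finrank_lt (f := B.mulVecLin) (by simp; omega))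
  let x : V → ℝ := fun u => ∑ i, c i * (S i).indicator 1 u
  have horth : ∀ j, t < hM.eigenvalues j → ⇑(hM.eigenvectorBasis j) ⬝ᵥ x = 0 := by
    intro j hj
    have hlt : (e.symm j : ℕ) < k - 1 := by
      by_contra! hle
      have := hanti (show (⟨k - 1, by omega⟩ : Fin (Fintype.card V)) ≤ e.symm j from hle)
      rw [← ht, hlam] at this
      simp only [Function.comp_apply, Equiv.apply_symm_apply] at this
      linarith
    have h0 := congrFun (LinearMap.mem_ker.mp hc) ⟨e.symm j, hlt⟩
    simp only [Matrix.mulVecLin_apply, Matrix.mulVec, B, dotProduct, Matrix.of_apply, Fin.eta,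
      Equiv.apply_symm_apply, Pi.zero_apply] at h0
    simp only [dotProduct, x, Finset.mul_sum]
    rw [Finset.sum_comm]
    refine Eq.trans ?_ h0
    refine Finset.sum_congr rfl fun i _ => ?_
    rw [Finset.sum_mul]
    exact Finset.sum_congr rfl fun u _ => by ring
  have hray := hM.dotProduct_mulVec_le t x horth
  rw [dotProduct_regularized_mulVec] at hray
  have hxx : x ⬝ᵥ x = ∑ i, c i ^ 2 * (S i).ncard := by
    simp only [dotProduct, ← sq, x, sq_sum_mul_indicator hdisj]
    rw [Finset.sum_comm]
    refine Finset.sum_congr rfl fun i _ => ?_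
    rw [← Finset.mul_sum, Set.ncard_eq_toFinset_card']
    simp [Set.indicator_apply]
  have hdir : (∑ u, ∑ v, if G.Adj u v then (x u - x v) ^ 2 else 0) / 2
      ≤ ∑ i, c i ^ 2 * (2 * (cutEdges G (S i)).ncard) := by
    calc _ ≤ (∑ u, ∑ v, ∑ i, 2 * c i ^ 2 * (if G.Adj u v then
          ((S i).indicator (1 : V → ℝ) u - (S i).indicator 1 v) ^ 2 else 0)) / 2 := by
          gcongr with u _ v _
          split_ifs
          · refine (sq_sub_sum_mul_indicator_le hdisj c u v).trans_eq ?_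
            rw [Finset.mul_sum]
            exact Finset.sum_congr rfl fun i _ => by ring
          · simp
      _ = ∑ i, c i ^ 2 * (2 * ((∑ u, ∑ v, if G.Adj u v then
          ((S i).indicator (1 : V → ℝ) u - (S i).indicator 1 v) ^ 2 else 0) / 2)) := by
          rw [Finset.sum_congr rfl fun u _ => Finset.sum_comm, Finset.sum_comm, Finset.sum_div]
          refine Finset.sum_congr rfl fun i _ => ?_
          simp only [← Finset.mul_sum]
          ring
      _ ≤ _ := by
          gcongr with i _
          exact sum_adj_indicator_sub_sq_le G (S i)
  have hcut : ∀ i, 2 * ((cutEdges G (S i)).ncard : ℝ) < (d - t) * (S i).ncard := by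
    intro i
    have hpos : (0 : ℝ) < (S i).ncard := by
      exact_mod_cast (Set.ncard_pos (Set.toFinite _)).mpr (hne i)
    have := hcon i
    rw [phi, div_lt_iff₀ hpos] at this
    linarith
  obtain ⟨i₀, hi₀⟩ := Function.ne_iff.mp hc0
  have hstrict : ∑ i, c i ^ 2 * (2 * ((cutEdges G (S i)).ncard : ℝ))
      < ∑ i, c i ^ 2 * ((d - t) * (S i).ncard) :=
    Finset.sum_lt_sum (fun i _ => mul_le_mul_of_nonneg_left (hcut i).le (sq_nonneg _))
      ⟨i₀, Finset.mem_univ _, mul_lt_mul_of_pos_left (hcut i₀) (sq_pos_of_ne_zero hi₀)⟩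
  have hfactor : ∑ i, c i ^ 2 * (((d : ℝ) - t) * (S i).ncard) = (d - t) * (x ⬝ᵥ x) := by
    rw [hxx, Finset.mul_sum]
    exact Finset.sum_congr rfl fun i _ => by ring
  rw [hfactor] at hstrict
  linarith
end

section
/- Let G be a connected graph with maximum degree Δ ≥ 2 and let S be a set of t ≥ 2 vertices of G. Then the average distance over pairs of vertices of S satisfies (1/binom(t,2))·Σ_{{u,v} ∈ binom(S,2)} δ_G(u,v) ≥ log(t/2)/(2·log Δ). -/
open SimpleGraph

/-- A sphere of radius `i` in a connected graph has at most `Δ ^ i` vertices. -/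
lemma card_dist_eq_le_maxDegree_pow {V : Type*} [Fintype V] [DecidableEq V] (G : SimpleGraph V)
    [DecidableRel G.Adj] (hconn : G.Connected) (u : V) (i : ℕ) :
    (Finset.univ.filter fun v => G.dist u v = i).card ≤ G.maxDegree ^ i := by
  induction i with
  | zero =>
    rw [pow_zero, Finset.card_le_one]
    intro a ha b hb
    simp only [Finset.mem_filter, Finset.mem_univ, true_and, hconn.dist_eq_zero_iff] at ha hb
    rw [← ha, ← hb]
  | succ i ih =>
    have hsub : (Finset.univ.filter fun v => G.dist u v = i + 1) ⊆
        (Finset.univ.filter fun v => G.dist u v = i).biUnion fun w => G.neighborFinset w := by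
      intro v hv
      simp only [Finset.mem_filter, Finset.mem_univ, true_and] at hv
      obtain ⟨p, hp⟩ := hconn.exists_walk_length_eq_dist v u
      rw [dist_comm, hv] at hp
      cases p with
      | nil => simp at hp
      | @cons _ w _ h q =>
        simp only [Walk.length_cons, Nat.add_right_cancel_iff] at hp
        simp only [Finset.mem_biUnion, Finset.mem_filter, Finset.mem_univ, true_and,
          mem_neighborFinset]
        refine ⟨w, ?_, h.symm⟩
        have h1 := dist_le q
        have h2 := hconn.dist_triangle (u := u) (v := w) (w := v)
        rw [dist_eq_one_iff_adj.mpr h.symm, dist_comm (u := u) (v := w)] at h2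
        rw [dist_comm]
        omega
    calc _ ≤ _ := Finset.card_le_card hsub
      _ ≤ (Finset.univ.filter fun v => G.dist u v = i).card * G.maxDegree :=
        Finset.card_biUnion_le_card_mul _ _ _ fun w _ => by
          rw [card_neighborFinset_eq_degree]; exact G.degree_le_maxDegree w
      _ ≤ _ := by rw [pow_succ]; exact Nat.mul_le_mul_right _ ih

/-- A Kraft-type inequality for the distances from a fixed vertex. -/
lemma sum_inv_maxDegree_sq_pow_dist_le_one {V : Type*} [Fintype V] [DecidableEq V]
    (G : SimpleGraph V) [DecidableRel G.Adj] (hconn : G.Connected) (hΔ : 2 ≤ G.maxDegree)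
    (u : V) (T : Finset V) (hu : u ∉ T) :
    ∑ v ∈ T, (((G.maxDegree : ℝ) ^ 2) ^ G.dist u v)⁻¹ ≤ 1 := by
  obtain ⟨N, hN⟩ : ∃ N, ∀ v ∈ T, G.dist u v < N :=
    ⟨T.sup (G.dist u) + 1, fun v hv => Nat.lt_succ_of_le (Finset.le_sup hv)⟩
  have hΔ' : (2 : ℝ) ≤ G.maxDegree := by exact_mod_cast hΔ
  have hmaps : ∀ v ∈ T, G.dist u v ∈ (Finset.range N).image Nat.succ := by
    intro v hv
    have hpos := hconn.pos_dist_of_ne (show u ≠ v from fun h => hu (h ▸ hv))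
    have := hN v hv
    exact Finset.mem_image.mpr ⟨G.dist u v - 1, Finset.mem_range.mpr (by omega), by omega⟩
  rw [← Finset.sum_fiberwise_of_maps_to hmaps,
    Finset.sum_image (fun _ _ _ _ h => Nat.succ_injective h)]
  have hlevel : ∀ i ∈ Finset.range N,
      ∑ v ∈ T with G.dist u v = i.succ, (((G.maxDegree : ℝ) ^ 2) ^ G.dist u v)⁻¹ ≤
        1 / 2 * (1 / 2 : ℝ) ^ i := by
    intro i _
    have hcard : ((T.filter fun v => G.dist u v = i + 1).card : ℝ) ≤
        (G.maxDegree : ℝ) ^ (i + 1) := by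
      exact_mod_cast (Finset.card_le_card (Finset.filter_subset_filter _ T.subset_univ)).trans
        (card_dist_eq_le_maxDegree_pow G hconn u (i + 1))
    have hpos : (0 : ℝ) < (G.maxDegree : ℝ) ^ (i + 1) := by positivity
    calc _ = ∑ v ∈ T with G.dist u v = i + 1, (((G.maxDegree : ℝ) ^ 2) ^ (i + 1))⁻¹ :=
          Finset.sum_congr rfl fun v hv => by rw [(Finset.mem_filter.mp hv).2]
      _ = ((T.filter fun v => G.dist u v = i + 1).card : ℝ) *
          (((G.maxDegree : ℝ) ^ 2) ^ (i + 1))⁻¹ := by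
          rw [Finset.sum_const, nsmul_eq_mul]
      _ ≤ (G.maxDegree : ℝ) ^ (i + 1) * (((G.maxDegree : ℝ) ^ 2) ^ (i + 1))⁻¹ := by gcongr
      _ = ((G.maxDegree : ℝ) ^ (i + 1))⁻¹ := by
          rw [← pow_mul, mul_comm 2, pow_mul]
          field_simp
      _ ≤ ((2 : ℝ) ^ (i + 1))⁻¹ := by gcongr
      _ = 1 / 2 * (1 / 2 : ℝ) ^ i := by rw [← pow_succ', one_div, inv_pow]
  refine (Finset.sum_le_sum hlevel).trans ?_
  rw [← Finset.mul_sum]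
  linarith [sum_geometric_two_le N]

/-- The distances from `u` to a nonempty set avoiding `u` have mean at least
`log |T| / (2 log Δ)`. -/
lemma card_mul_log_card_le_sum_dist {V : Type*} [Fintype V] [DecidableEq V]
    (G : SimpleGraph V) [DecidableRel G.Adj] (hconn : G.Connected) (hΔ : 2 ≤ G.maxDegree)
    (u : V) (T : Finset V) (hu : u ∉ T) (hT : T.Nonempty) :
    T.card * Real.log T.card ≤ 2 * Real.log G.maxDegree * ∑ v ∈ T, (G.dist u v : ℝ) := by
  have hpos : (0 : ℝ) < T.card := by exact_mod_cast hT.card_pos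
  have hΔpos : (0 : ℝ) < G.maxDegree := by exact_mod_cast (by omega : 0 < G.maxDegree)
  have hterm : ∀ v ∈ T, Real.log T.card - 2 * Real.log G.maxDegree * G.dist u v + 1 ≤
      T.card * (((G.maxDegree : ℝ) ^ 2) ^ G.dist u v)⁻¹ := by
    intro v _
    have h := Real.log_le_sub_one_of_pos
      (show (0 : ℝ) < T.card * (((G.maxDegree : ℝ) ^ 2) ^ G.dist u v)⁻¹ by positivity)
    rw [Real.log_mul hpos.ne' (by positivity), Real.log_inv, Real.log_pow, Real.log_pow] at h
    push_cast at h
    linarith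
  have hsum := Finset.sum_le_sum hterm
  rw [← Finset.mul_sum, Finset.sum_add_distrib, Finset.sum_sub_distrib, ← Finset.mul_sum] at hsum
  simp only [Finset.sum_const, nsmul_eq_mul, mul_one] at hsum
  have := mul_le_mul_of_nonneg_left
    (sum_inv_maxDegree_sq_pow_dist_le_one G hconn hΔ u T hu) hpos.le
  linarith

/-- Claim 3.4: if `G` is a connected graph with maximum degree `Δ ≥ 2` and `S` is a set of
`t ≥ 2` vertices, then the average distance over (unordered) pairs of vertices of `S` is at
least `log(t/2)/(2 log Δ)`. (The sum over ordered pairs of distinct vertices divided by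
`t(t−1)` equals the average over unordered pairs.) -/
theorem stmt10 {V : Type} [Fintype V] [DecidableEq V] (G : SimpleGraph V)
    [DecidableRel G.Adj] (hconn : G.Connected)
    (Δ : ℕ) (hΔ : G.maxDegree = Δ) (hΔ2 : 2 ≤ Δ)
    (S : Finset V) (t : ℕ) (hS : S.card = t) (ht : 2 ≤ t) :
    Real.logb 2 ((t : ℝ) / 2) / (2 * Real.logb 2 Δ) ≤
      ((∑ p ∈ S.offDiag, G.dist p.1 p.2 : ℕ) : ℝ) / ((t : ℝ) * ((t : ℝ) - 1)) := by
  subst hΔ hS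
  have ht' : (2 : ℝ) ≤ S.card := by exact_mod_cast ht
  have hlogΔ : 0 < Real.log G.maxDegree := Real.log_pos (by exact_mod_cast hΔ2)
  have hrow : ∀ u ∈ S, ((S.card : ℝ) - 1) * Real.log (S.card / 2) ≤
      2 * Real.log G.maxDegree * ∑ v ∈ S.erase u, (G.dist u v : ℝ) := by
    intro u hu
    have hcard := Finset.card_erase_of_mem hu
    have h := card_mul_log_card_le_sum_dist G hconn hΔ2 u (S.erase u) (S.notMem_erase u)
      (Finset.card_pos.mp (by omega))
    rw [hcard, Nat.cast_sub (by omega), Nat.cast_one] at h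
    refine le_trans ?_ h
    exact mul_le_mul_of_nonneg_left (Real.log_le_log (by linarith) (by linarith)) (by linarith)
  have hsplit : ((∑ p ∈ S.offDiag, G.dist p.1 p.2 : ℕ) : ℝ) =
      ∑ u ∈ S, ∑ v ∈ S.erase u, (G.dist u v : ℝ) := by
    push_cast
    refine Finset.sum_finset_product' S.offDiag S (fun u => S.erase u) (fun p => ?_)
      (f := fun u v => (G.dist u v : ℝ))
    simp only [Finset.mem_offDiag, Finset.mem_erase]
    tauto
  have hsum := Finset.sum_le_sum hrow
  rw [Finset.sum_const, nsmul_eq_mul, ← Finset.mul_sum, ← hsplit] at hsum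
  have hratio : Real.logb 2 ((S.card : ℝ) / 2) / (2 * Real.logb 2 G.maxDegree) =
      Real.log (S.card / 2) / (2 * Real.log G.maxDegree) := by
    have h2 : Real.log 2 ≠ 0 := (Real.log_pos one_lt_two).ne'
    simp only [Real.logb]
    field_simp
  rw [hratio, div_le_div_iff₀ (by positivity) (mul_pos (by linarith) (by linarith))]
  linarith
end

section
/- Let G be a connected graph on n vertices that is not a tree (i.e., contains a cycle), and suppose G has edge expansion at least α for some real α > 0, meaning every nonempty S ⊆ V(G) with |S| ≤ n/2 satisfies |∂_G(S)| ≥ α·|S|. Then the girth of G is at most 2·(2/α + 1)·(ln n + 1) + 1. In particular, if additionally α ≤ 1, then the girth of G is at most 12·ln(n)/α. -/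
open SimpleGraph

/-- The ball of radius `r` around `v` in the graph metric. -/
def graphBall {V : Type*} (G : SimpleGraph V) (v : V) (r : ℕ) : Set V :=
  {x | G.dist v x ≤ r}

theorem cutEdges_compl {V : Type*} (G : SimpleGraph V) (A : Set V) :
    cutEdges G Aᶜ = cutEdges G A := by
  ext e
  simp only [cutEdges, Set.mem_ofPred_eq, compl_compl]
  refine and_congr_right fun _ ↦ ⟨?_, ?_⟩ <;>
  · rintro ⟨u, hu, v, hv, rfl⟩
    exact ⟨v, hv, u, hu, Sym2.eq_swap⟩

/-- In a connected graph without cycles of length at most `2 * r + 2`, a vertex outside the ball of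
radius `r` has at most one neighbour in this ball. -/
theorem eq_of_adj_of_mem_graphBall {V : Type*} {G : SimpleGraph V} (hconn : G.Connected)
    {v u u' x : V} {r : ℕ} (hlen : ∀ (y : V) (w : G.Walk y y), w.IsCycle → 2 * r + 2 < w.length)
    (hu : u ∈ graphBall G v r) (hu' : u' ∈ graphBall G v r) (hx : x ∉ graphBall G v r)
    (hux : G.Adj u x) (hux' : G.Adj u' x) : u = u' := by
  classical
  by_contra hne
  simp only [graphBall, Set.mem_ofPred_eq, not_le] at hu hu' hx
  obtain ⟨p, hp, hpl⟩ := hconn.exists_path_of_dist v u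
  obtain ⟨q, hq, hql⟩ := hconn.exists_path_of_dist v u'
  have notMem {a : V} (s : G.Walk v a) (hs : s.length ≤ r) : x ∉ s.support := fun hmem ↦ by
    have h₁ := SimpleGraph.dist_le (s.takeUntil x hmem)
    have h₂ := s.length_takeUntil_le_length hmem
    omega
  have hne' : p.concat hux ≠ q.concat hux' := fun h ↦ hne <| by
    simpa using congrArg Walk.penultimate h
  obtain ⟨y, w, hw, hwl⟩ : ∃ (y : V) (w : G.Walk y y), w.IsCycle ∧
      w.length ≤ (p.concat hux).length + (q.concat hux').length := by
    have := (hp.concat (notMem p (by omega)) hux).exists_isCycle_length_le_add_of_ne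
      (hq.concat (notMem q (by omega)) hux') hne'
    grind
  have := hlen y w hw
  simp only [Walk.length_concat] at hwl
  omega

theorem ncard_cutEdges_graphBall_add_le {V : Type*} [Finite V] {G : SimpleGraph V}
    (hconn : G.Connected) (v : V) {r : ℕ}
    (hlen : ∀ (y : V) (w : G.Walk y y), w.IsCycle → 2 * r + 2 < w.length) :
    (cutEdges G (graphBall G v r)).ncard + (graphBall G v r).ncard ≤
      (graphBall G v (r + 1)).ncard := by
  have hsub : graphBall G v r ⊆ graphBall G v (r + 1) := fun x hx ↦ Nat.le_succ_of_le hx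
  rw [← Set.ncard_sdiff_add_ncard_of_subset hsub]
  gcongr
  have : Nonempty V := ⟨v⟩
  let f : V → Sym2 V := fun x ↦
    s(Classical.epsilon fun u ↦ u ∈ graphBall G v r ∧ G.Adj u x, x)
  refine (Set.ncard_le_ncard ?_ (Set.toFinite _)).trans
    (Set.ncard_image_le (f := f) (Set.toFinite _))
  rintro e ⟨he, u, hu, x, hx, rfl⟩
  rw [SimpleGraph.mem_edgeSet] at he
  refine ⟨x, ⟨?_, hx⟩, ?_⟩
  · have h₁ := hconn.dist_triangle (u := v) (v := u) (w := x)
    have h₂ : G.dist u x = 1 := SimpleGraph.dist_eq_one_iff_adj.mpr he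
    simp only [graphBall, Set.mem_ofPred_eq] at hu ⊢
    omega
  · have hspec := Classical.epsilon_spec (p := fun u ↦ u ∈ graphBall G v r ∧ G.Adj u x)
      ⟨u, hu, he⟩
    simp only [f]
    rw [eq_of_adj_of_mem_graphBall hconn hlen hspec.1 hu hx hspec.2 he]

/-- If a ball of radius `r` around a vertex of a cycle covers the graph, then the graph has a cycle
of length at most `2 * r + 1`. -/
theorem exists_isCycle_length_le_of_graphBall_eq_univ {V : Type*} {G : SimpleGraph V}
    (hconn : G.Connected) {v : V} {c : G.Walk v v} (hc : c.IsCycle) {r : ℕ}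
    (hball : graphBall G v r = Set.univ) :
    ∃ (y : V) (w : G.Walk y y), w.IsCycle ∧ w.length ≤ 2 * r + 1 := by
  by_cases hcl : c.length ≤ 2 * r + 1
  · exact ⟨v, c, hc, hcl⟩
  by_cases hr : r + 1 < c.length
  · obtain ⟨p, hp, hpl⟩ := hconn.exists_path_of_dist v (c.getVert (r + 1))
    have hdist : c.getVert (r + 1) ∈ graphBall G v r := hball ▸ Set.mem_univ _
    simp only [graphBall, Set.mem_ofPred_eq] at hdist
    have hlen : (c.take (r + 1)).length = r + 1 := by rw [Walk.take_length]; omega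
    have hne : p ≠ c.take (r + 1) := fun h ↦ by
      have := congrArg Walk.length h
      omega
    have := hp.exists_isCycle_length_le_add_of_ne (hc.isPath_take hr) hne
    grind
  · have := hc.three_le_length
    omega

theorem exp_mul_le_of_growth {b : ℕ → ℝ} {c m : ℝ} {R : ℕ} (h0 : 1 ≤ b 0)
    (hstep : ∀ r < R, b r ≤ m → Real.exp c * b r ≤ b (r + 1))
    (hle : ∀ r < R, b r ≤ m) : Real.exp (c * R) ≤ b R := by
  induction R with
  | zero => simpa using h0
  | succ k ih =>
    have := ih (fun r hr ↦ hstep r (by omega)) (fun r hr ↦ hle r (by omega))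
    calc Real.exp (c * (k + 1 : ℕ)) = Real.exp c * Real.exp (c * k) := by
          rw [← Real.exp_add]; push_cast; ring_nf
      _ ≤ Real.exp c * b k := by gcongr
      _ ≤ b (k + 1) := hstep k (by omega) (hle k (by omega))

/-- In a connected graph with edge expansion at least `α` without cycles of length at most
`2 * (R + T) + 1`, the balls of radius `R + T` cover the graph as soon as `R` and `T` are large
enough. -/
theorem graphBall_eq_univ_of_expansion {V : Type*} [Fintype V] {G : SimpleGraph V}
    (hconn : G.Connected) {α : ℝ} (hα : 0 < α)
    (hexp : ∀ S : Set V, S.Nonempty → (S.ncard : ℝ) ≤ (Fintype.card V : ℝ) / 2 →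
      α * (S.ncard : ℝ) ≤ ((cutEdges G S).ncard : ℝ))
    {R T : ℕ} (hR : Real.log (Fintype.card V / 2) < 2 * α / (α + 2) * R)
    (hT : Real.log (Fintype.card V / 2) < α * T)
    (hlen : ∀ (y : V) (w : G.Walk y y), w.IsCycle → 2 * (R + T) + 1 < w.length) (v : V) :
    graphBall G v (R + T) = Set.univ := by
  set n := Fintype.card V
  have hn0 : (0 : ℝ) < n / 2 := by
    have : 0 < n := Fintype.card_pos_iff.mpr ⟨v⟩
    positivity
  set b : ℕ → ℝ := fun r ↦ (graphBall G v r).ncard with hb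
  have hcut : ∀ r < R + T, ((cutEdges G (graphBall G v r)).ncard : ℝ) + b r ≤ b (r + 1) := by
    intro r hr
    have := ncard_cutEdges_graphBall_add_le (r := r) hconn v
      fun y w hw ↦ by have := hlen y w hw; omega
    simp only [hb]
    exact_mod_cast this
  have hmono : Monotone b := fun r s hrs ↦ by
    simp only [hb, Nat.cast_le]
    exact Set.ncard_le_ncard (fun x hx ↦ le_trans hx hrs) (Set.toFinite _)
  have hmem : ∀ r, v ∈ graphBall G v r := fun r ↦ by simp [graphBall]
  have hc : Real.exp (2 * α / (α + 2)) ≤ 1 + α := by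
    rw [← Real.le_log_iff_exp_le (by positivity)]
    exact Real.le_log_one_add_of_nonneg hα.le
  have hhalf : n / 2 < b R := by
    by_contra! hle
    have hgrow := exp_mul_le_of_growth (b := b) (c := 2 * α / (α + 2)) (m := n / 2) (R := R)
      (by
        simp only [hb, Nat.one_le_cast]
        exact (Set.ncard_pos (Set.toFinite _)).mpr ⟨v, hmem 0⟩)
      (fun r hr hbr ↦ by
        have h₁ := hcut r (by omega)
        have h₂ : α * b r ≤ _ := hexp _ ⟨v, hmem r⟩ hbr
        have h₃ : Real.exp (2 * α / (α + 2)) * b r ≤ (1 + α) * b r := by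
          gcongr
        linarith)
      (fun r hr ↦ (hmono hr.le).trans hle)
    have := (Real.log_lt_iff_lt_exp hn0).mp hR
    linarith
  have hcompl : ∀ r, ((graphBall G v r)ᶜ.ncard : ℝ) = n - b r := fun r ↦ by
    have := Set.ncard_add_ncard_compl (graphBall G v r)
    rw [Nat.card_eq_fintype_card] at this
    simp only [hb, eq_sub_iff_add_eq']
    exact_mod_cast this
  have hdecay : ∀ t ≤ T, n - b (R + t) ≤ Real.exp (-(α * t)) * (n / 2) := by
    intro t
    induction t with
    | zero => intro _; simp; linarith
    | succ t ih =>
      intro ht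
      have h₀ := ih (by omega)
      have h₁ := hcut (R + t) (by omega)
      have hnn : 0 ≤ n - b (R + t) := by rw [← hcompl]; positivity
      have h₂ : α * (n - b (R + t)) ≤ (cutEdges G (graphBall G v (R + t))).ncard := by
        rcases (graphBall G v (R + t))ᶜ.eq_empty_or_nonempty with he | hne
        · rw [← hcompl, he]; simp
        · have := hexp _ hne (by
            rw [hcompl]
            have := hmono (Nat.le_add_right R t)
            linarith)
          rwa [hcompl, cutEdges_compl] at this
      calc n - b (R + (t + 1)) ≤ (-α + 1) * (n - b (R + t)) := by
            rw [← add_assoc]; linarith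
        _ ≤ Real.exp (-α) * (n - b (R + t)) := by gcongr; exact Real.add_one_le_exp _
        _ ≤ Real.exp (-α) * (Real.exp (-(α * t)) * (n / 2)) := by gcongr
        _ = Real.exp (-(α * (t + 1 : ℕ))) * (n / 2) := by
            rw [← mul_assoc, ← Real.exp_add]; push_cast; ring_nf
  have hlt : n - b (R + T) < 1 := by
    refine (hdecay T le_rfl).trans_lt ?_
    calc Real.exp (-(α * T)) * (n / 2) < Real.exp (-(α * T)) * Real.exp (α * T) := by
          gcongr; exact (Real.log_lt_iff_lt_exp hn0).mp hT
      _ = 1 := by rw [← Real.exp_add]; simp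
  rw [← hcompl] at hlt
  have : (graphBall G v (R + T))ᶜ.ncard = 0 := Nat.lt_one_iff.mp (by exact_mod_cast hlt)
  rwa [Set.ncard_eq_zero (Set.toFinite _), Set.compl_empty_iff] at this

theorem SimpleGraph.Walk.IsCycle.length_le_card {V : Type*} [Fintype V] {G : SimpleGraph V} {v : V}
    {c : G.Walk v v} (hc : c.IsCycle) : c.length ≤ Fintype.card V := by
  simpa using hc.support_nodup.length_le_card

/-- The girth bound obtained by growing a ball until it exceeds half of the vertices and then until
it covers the graph. -/
theorem exists_isCycle_length_le_of_expansion {V : Type*} [Fintype V] {G : SimpleGraph V}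
    (hconn : G.Connected) {v : V} {c : G.Walk v v} (hc : c.IsCycle) {α : ℝ} (hα : 0 < α)
    (hexp : ∀ S : Set V, S.Nonempty → (S.ncard : ℝ) ≤ (Fintype.card V : ℝ) / 2 →
      α * (S.ncard : ℝ) ≤ ((cutEdges G S).ncard : ℝ)) :
    ∃ (y : V) (w : G.Walk y y), w.IsCycle ∧
      (w.length : ℝ) ≤ (4 / α + 1) * Real.log (Fintype.card V / 2) + 5 := by
  set L := Real.log (Fintype.card V / 2)
  have hL0 : 0 ≤ L := by
    refine Real.log_nonneg ?_
    have : (3 : ℝ) ≤ Fintype.card V := by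
      exact_mod_cast hc.three_le_length.trans hc.length_le_card
    linarith
  set R := ⌊(1 / α + 1 / 2) * L⌋₊ + 1 with hR
  set T := ⌊1 / α * L⌋₊ + 1 with hT
  have hRlt : (1 / α + 1 / 2) * L < R := by exact_mod_cast Nat.lt_floor_add_one _
  have hTlt : 1 / α * L < T := by exact_mod_cast Nat.lt_floor_add_one _
  have hRle : (R : ℝ) ≤ (1 / α + 1 / 2) * L + 1 := by
    push_cast [hR]; gcongr; exact Nat.floor_le (by positivity)
  have hTle : (T : ℝ) ≤ 1 / α * L + 1 := by
    push_cast [hT]; gcongr; exact Nat.floor_le (by positivity)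
  obtain ⟨y, w, hw, hwl⟩ : ∃ (y : V) (w : G.Walk y y), w.IsCycle ∧
      w.length ≤ 2 * (R + T) + 1 := by
    by_contra! hlen
    obtain ⟨y, w, hw, hwl⟩ := exists_isCycle_length_le_of_graphBall_eq_univ hconn hc
      (graphBall_eq_univ_of_expansion hconn hα hexp (R := R) (T := T)
        (calc L = 2 * α / (α + 2) * ((1 / α + 1 / 2) * L) := by field_simp; ring
          _ < _ := by gcongr)
        (calc L = α * (1 / α * L) := by field_simp
          _ < _ := by gcongr) hlen v)
    exact (hlen y w hw).not_ge hwl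
  refine ⟨y, w, hw, ?_⟩
  have : (w.length : ℝ) ≤ 2 * (R + T) + 1 := by exact_mod_cast hwl
  calc (w.length : ℝ) ≤ 2 * ((1 / α + 1 / 2) * L + 1 + (1 / α * L + 1)) + 1 := by linarith
    _ = (4 / α + 1) * L + 5 := by ring

/-- Lemma 3.5: a connected `n`-vertex graph with edge expansion at least `α > 0` that is not
a tree has girth at most `2(2/α + 1)(ln n + 1) + 1`; in particular, if `α ≤ 1` then the girth
is at most `12 ln(n)/α`. -/
theorem stmt11 {V : Type} [Fintype V] (G : SimpleGraph V) (n : ℕ)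
    (hn : Fintype.card V = n) (hconn : G.Connected)
    (hcyc : ∃ (v : V) (w : G.Walk v v), w.IsCycle)
    (α : ℝ) (hα : 0 < α)
    (hexp : ∀ S : Set V, S.Nonempty → (S.ncard : ℝ) ≤ (n : ℝ) / 2 →
      α * (S.ncard : ℝ) ≤ ((cutEdges G S).ncard : ℝ)) :
    (∃ (v : V) (w : G.Walk v v), w.IsCycle ∧
      (w.length : ℝ) ≤ 2 * (2 / α + 1) * (Real.log n + 1) + 1) ∧
    (α ≤ 1 → ∃ (v : V) (w : G.Walk v v), w.IsCycle ∧
      (w.length : ℝ) ≤ 12 * Real.log n / α) := by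
  subst hn
  obtain ⟨v, c, hc⟩ := hcyc
  have hcard : 3 ≤ Fintype.card V := hc.three_le_length.trans hc.length_le_card
  have hlog2 := Real.log_two_gt_d9
  have hpos : 0 < 1 / α := by positivity
  set n := Fintype.card V
  have hn0 : (0 : ℝ) < n := by positivity
  have hlog_one : 1 ≤ Real.log n := by
    rw [Real.le_log_iff_exp_le hn0]
    have : (3 : ℝ) ≤ n := by exact_mod_cast hcard
    linarith [Real.exp_one_lt_d9]
  obtain ⟨y, w, hw, hwl⟩ := exists_isCycle_length_le_of_expansion hconn hc hα hexp
  rw [Real.log_div hn0.ne' two_ne_zero] at hwl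
  constructor
  · rw [show 2 * (2 / α + 1) * (Real.log n + 1) + 1 =
      4 * (1 / α * Real.log n) + 4 * (1 / α) + 2 * Real.log n + 3 by ring]
    have hprod : 0 < 1 / α * Real.log n := by positivity
    by_cases h3 : n = 3
    · refine ⟨v, c, hc, ?_⟩
      have : (c.length : ℝ) ≤ 3 := by exact_mod_cast hc.length_le_card.trans_eq h3
      linarith
    · refine ⟨y, w, hw, ?_⟩
      have h4 : 2 * Real.log 2 ≤ Real.log n := by
        have h4 : (2 : ℝ) ^ 2 ≤ n := by exact_mod_cast (show 2 ^ 2 ≤ n by omega)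
        simpa using Real.log_le_log (by positivity) h4
      rw [show (4 / α + 1) * (Real.log n - Real.log 2) + 5 = 4 * (1 / α * Real.log n)
        - 4 * (1 / α * Real.log 2) + Real.log n - Real.log 2 + 5 by ring] at hwl
      have : 0 < 1 / α * Real.log 2 := by positivity
      linarith
  · intro hα1
    refine ⟨y, w, hw, hwl.trans ?_⟩
    have hone : 1 ≤ 1 / α := by rwa [le_div_iff₀ hα, one_mul]
    calc (4 / α + 1) * (Real.log n - Real.log 2) + 5
        ≤ (4 / α + 1) * Real.log n + 5 * 1 := by gcongr <;> linarith
      _ ≤ (4 / α + 1 / α) * Real.log n + 5 * (1 / α * Real.log n) := by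
          gcongr
          exact one_le_mul_of_one_le_of_one_le hone hlog_one
      _ = 10 * (1 / α * Real.log n) := by ring
      _ ≤ 12 * (1 / α * Real.log n) := by gcongr; norm_num
      _ = 12 * Real.log n / α := by ring
end

section
/- Let G be a graph on n vertices and let f : [n/3, n] → ℝ be a decreasing function such that for every integer t with n/3 ≤ t ≤ n, every induced subgraph of G on t vertices has edge expansion at most f(t) (i.e., contains a nonempty subset S of size at most t/2 with |∂(S)| ≤ f(t)·|S|, where the edge boundary is taken within that induced subgraph). Then sep(G) ≤ (2/3)·n·f(n/3). -/
open SimpleGraph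

/-- `sep G`: minimum size of an edge separator of `G`. -/
noncomputable def sep {V : Type*} (G : SimpleGraph V) : ℕ :=
  sInf { m : ℕ | ∃ A : Set V, 3 * A.ncard ≤ 2 * Nat.card V ∧
      3 * Aᶜ.ncard ≤ 2 * Nat.card V ∧ m = (cutEdges G A).ncard }

/-- Removing `S ⊆ B` from `B` only adds to the cut of `B` edges of the cut of `S` inside `B`. -/
theorem cutEdges_diff_subset {V : Type*} (G : SimpleGraph V) (B : Set V) (S : Set ↥B) :
    cutEdges G (B \ Subtype.val '' S) ⊆
      cutEdges G B ∪ Sym2.map Subtype.val '' cutEdges (G.induce B) S := by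
  rintro e ⟨he, u, ⟨huB, huS⟩, v, hv, rfl⟩
  by_cases hvB : v ∈ B
  · have hvS : (⟨v, hvB⟩ : ↥B) ∈ S := by
      by_contra h
      refine hv ⟨hvB, ?_⟩
      rintro ⟨w, hw, rfl⟩
      exact h hw
    refine Or.inr ⟨s(⟨v, hvB⟩, ⟨u, huB⟩), ⟨?_, ⟨v, hvB⟩, hvS, ⟨u, huB⟩, ?_, rfl⟩, ?_⟩
    · exact G.adj_symm he
    · exact fun h => huS ⟨_, h, rfl⟩
    · exact Sym2.eq_swap
  · exact Or.inl ⟨he, u, huB, v, hvB, rfl⟩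

theorem ncard_cutEdges_diff_le {V : Type*} [Finite V] (G : SimpleGraph V) (B : Set V)
    (S : Set ↥B) :
    (cutEdges G (B \ Subtype.val '' S)).ncard ≤
      (cutEdges G B).ncard + (cutEdges (G.induce B) S).ncard :=
  (Set.ncard_le_ncard (cutEdges_diff_subset G B S) (Set.toFinite _)).trans <|
    (Set.ncard_union_le _ _).trans <|
      Nat.add_le_add_left (Set.ncard_image_le (Set.toFinite _)) _

theorem cutEdges_univ {V : Type*} (G : SimpleGraph V) : cutEdges G Set.univ = ∅ := by
  ext e
  simp [cutEdges]

/-- Lemma 3.6: let `G` be an `n`-vertex graph and `f` a decreasing function on `[n/3, n]`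
such that every induced subgraph of `G` on `t` vertices (`n/3 ≤ t ≤ n`) has edge expansion
at most `f(t)`. Then `sep(G) ≤ (2/3)·n·f(n/3)`. -/
theorem stmt12 {V : Type} [Fintype V] (G : SimpleGraph V) (n : ℕ)
    (hn : Fintype.card V = n) (f : ℝ → ℝ)
    (hf : ∀ x y : ℝ, (n : ℝ) / 3 ≤ x → x ≤ y → y ≤ (n : ℝ) → f y ≤ f x)
    (hexp : ∀ (s : Set V) (t : ℕ), s.ncard = t →
      (n : ℝ) / 3 ≤ (t : ℝ) → t ≤ n →
      ∃ S : Set ↥s, S.Nonempty ∧ 2 * S.ncard ≤ t ∧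
        ((cutEdges (G.induce s) S).ncard : ℝ) ≤ f t * (S.ncard : ℝ)) :
    (sep G : ℝ) ≤ (2 / 3) * (n : ℝ) * f ((n : ℝ) / 3) := by
  have hcard : Nat.card V = n := by rw [Nat.card_eq_fintype_card, hn]
  have huniv : (Set.univ : Set V).ncard = n := by rw [Set.ncard_univ, hcard]
  have hn0 : (0 : ℝ) ≤ n := n.cast_nonneg
  set c := f ((n : ℝ) / 3)
  have hc : 0 ≤ c := by
    obtain ⟨S, hS, -, hle⟩ := hexp Set.univ n huniv (by linarith) le_rfl
    have hpos : (0 : ℝ) < S.ncard := by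
      exact_mod_cast (Set.ncard_pos (Set.toFinite S)).2 hS
    have hfn : 0 ≤ f n := nonneg_of_mul_nonneg_left (le_trans (Nat.cast_nonneg _) hle) hpos
    exact hfn.trans (hf _ _ le_rfl (by linarith) le_rfl)
  obtain ⟨B, ⟨hBlow, hBcut⟩, hBmin⟩ := exists_minimalFor_of_wellFoundedLT
    (fun B : Set V => n ≤ 3 * B.ncard ∧ ((cutEdges G B).ncard : ℝ) ≤ c * ((n : ℝ) - B.ncard))
    Set.ncard ⟨Set.univ, by simp [huniv, cutEdges_univ]; omega⟩
  have hBn : B.ncard ≤ n := huniv ▸ Set.ncard_le_ncard (Set.subset_univ B) (Set.toFinite _)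
  have hBlow' : (n : ℝ) / 3 ≤ B.ncard := by
    have : (n : ℝ) ≤ 3 * B.ncard := by exact_mod_cast hBlow
    linarith
  have hBup : 3 * B.ncard ≤ 2 * n := by
    by_contra! hlt
    obtain ⟨S, hS, hS2, hle⟩ := hexp B B.ncard rfl hBlow' hBn
    have hSpos : 0 < S.ncard := (Set.ncard_pos (Set.toFinite S)).2 hS
    have himg : (Subtype.val '' S).ncard = S.ncard :=
      Set.ncard_image_of_injective _ Subtype.val_injective
    have hdiff : (B \ Subtype.val '' S).ncard + S.ncard = B.ncard := by
      rw [← himg]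
      exact Set.ncard_sdiff_add_ncard_of_subset (by simp) (Set.toFinite _)
    have hcut : ((cutEdges G (B \ Subtype.val '' S)).ncard : ℝ) ≤
        (cutEdges G B).ncard + (cutEdges (G.induce B) S).ncard := by
      exact_mod_cast ncard_cutEdges_diff_le G B S
    have hfc : f B.ncard * S.ncard ≤ c * S.ncard :=
      mul_le_mul_of_nonneg_right (hf _ _ le_rfl hBlow' (by exact_mod_cast hBn))
        (Nat.cast_nonneg _)
    have hdiff' : ((B \ Subtype.val '' S).ncard : ℝ) = B.ncard - S.ncard := by
      rw [← hdiff]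
      push_cast
      ring
    have := hBmin (j := B \ Subtype.val '' S) ⟨by omega, by rw [hdiff']; linarith⟩ (by omega)
    omega
  have hcompl : B.ncard + Bᶜ.ncard = n := by rw [Set.ncard_add_ncard_compl, hcard]
  have hsep : sep G ≤ (cutEdges G B).ncard :=
    Nat.sInf_le ⟨B, by rw [hcard]; exact hBup, by rw [hcard]; omega, rfl⟩
  calc (sep G : ℝ) ≤ (cutEdges G B).ncard := by exact_mod_cast hsep
    _ ≤ c * ((n : ℝ) - B.ncard) := hBcut
    _ ≤ c * (2 / 3 * n) := mul_le_mul_of_nonneg_left (by linarith) hc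
    _ = 2 / 3 * n * c := by ring
end
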